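/- arXiv:1001.0586 — 14 statements merged into one kernel-verified Lean document; each statement's English description precedes it below -/
import Mathlib

section
/- Let a = (3/320)·(290,107,−7), b = (3/320)·(−34,277,135), c = (3/320)·(94,−83,247), d = (1/320)·(38,5,−25). Then the double dimer configuration determined by (a,b,c,d) is a packing: any two distinct members of the family {F₂+ℓ : ℓ ∈ L⁺} ∪ {(−F₂)+m : m ∈ L⁻} have disjoint interiors. -/
open Matrix MeasureTheory

noncomputable section

/-- Points of ℝ³. -/
abbrev V3 := Fin 3 → ℝ

/-- The vertices of the dimer. -/
def po : V3 := ![2, 2, 2]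
def pp : V3 := ![2, -1, -1]
def pq : V3 := ![-1, 2, -1]
def pr : V3 := ![-1, -1, 2]
def ps : V3 := ![-2, -2, -2]

/-- The positive dimer: convex hull of o, p, q, r, s. -/
def F2 : Set V3 := convexHull ℝ {po, pp, pq, pr, ps}

/-- The negative dimer: image of F₂ under the point reflection x ↦ -x. -/
def negF2 : Set V3 := (fun x => -x) '' F2

/-- L⁺ : integer combinations nₐ·a + n_b·b + n_c·c with nₐ+n_b+n_c even. -/
def Lplus (a b c : V3) : Set V3 :=
  {x | ∃ na nb nc : ℤ, Even (na + nb + nc) ∧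
    x = (na : ℝ) • a + (nb : ℝ) • b + (nc : ℝ) • c}

/-- L⁻ : integer combinations nₐ·a + n_b·b + n_c·c with nₐ+n_b+n_c odd, translated by d. -/
def Lminus (a b c d : V3) : Set V3 :=
  {x | ∃ na nb nc : ℤ, Odd (na + nb + nc) ∧
    x = (na : ℝ) • a + (nb : ℝ) • b + (nc : ℝ) • c + d}

/-- The double dimer configuration determined by (a,b,c,d). -/
def config (a b c d : V3) : Set (Set V3) :=
  {S | ∃ l ∈ Lplus a b c, S = (· + l) '' F2} ∪
  {S | ∃ m ∈ Lminus a b c d, S = (· + m) '' negF2}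

/-- A family of sets is a packing if distinct members have disjoint interiors. -/
def IsPacking (C : Set (Set V3)) : Prop :=
  ∀ S ∈ C, ∀ T ∈ C, S ≠ T → interior S ∩ interior T = ∅

/-- Determinant of the 3×3 matrix with columns x, y, z. -/
def det3 (x y z : V3) : ℝ := Matrix.det (Matrix.of fun i j => ![x, y, z] j i)

/-- The three-parameter family: lattice vectors a, b, c and offset d. -/
def av (u v w : ℝ) : V3 := ![27/10 + u, 21/20 - v, -3/20 + 2*u + v]
def bv (u v w : ℝ) : V3 := ![-3/10 - u, 51/20 + v, 27/20 - 2*u - v]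
def cv (u v w : ℝ) : V3 :=
  ![129/160 - u + 2*v + 2*w, -237/320 + u/2 - v + 3*w, 753/320 + u/2 - v + w]
def dv (u v w : ℝ) : V3 := ![1/10 + u, -1/20 + u + v, -1/20 + u - v]

/-- F[x,y,z] : the affine plane (affine span) through x, y, z. -/
def Fpl (x y z : V3) : Set V3 := (affineSpan ℝ {x, y, z} : Set V3)

/-- E[x,y] : the affine line through x and y. -/
def Eln (x y : V3) : Set V3 := (affineSpan ℝ {x, y} : Set V3)

/-- `u` is bounded by `c` on the five vertices of the dimer, for `u` with coordinates `p, q, r`. -/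
def DimerBound (p q r c : ℤ) : Prop :=
  2 * p + 2 * q + 2 * r ≤ c ∧ 2 * p - q - r ≤ c ∧ -p + 2 * q - r ≤ c ∧
    -p - q + 2 * r ≤ c ∧ -2 * p - 2 * q - 2 * r ≤ c

instance (p q r c : ℤ) : Decidable (DimerBound p q r c) := by
  unfold DimerBound; infer_instance

/-- The linear functional with integer coordinates `p, q, r`. -/
def form (p q r : ℤ) (x : V3) : ℝ := p * x 0 + q * x 1 + r * x 2

lemma form_add (p q r : ℤ) (x y : V3) : form p q r (x + y) = form p q r x + form p q r y := by
  simp only [form, Pi.add_apply]; ring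

lemma form_smul (p q r : ℤ) (t : ℝ) (x : V3) : form p q r (t • x) = t * form p q r x := by
  simp only [form, Pi.smul_apply, smul_eq_mul]; ring

lemma form_neg (p q r : ℤ) (x : V3) : form p q r (-x) = -form p q r x := by
  simp only [form, Pi.neg_apply]; ring

lemma form_neg_coeff (p q r : ℤ) (x : V3) : form (-p) (-q) (-r) x = -form p q r x := by
  simp only [form]; push_cast; ring

lemma form_le_of_mem_F2 {p q r c : ℤ} (h : DimerBound p q r c) {x : V3} (hx : x ∈ F2) :
    form p q r x ≤ c := by
  have hconv : Convex ℝ {y : V3 | form p q r y ≤ c} :=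
    convex_halfSpace_le ⟨form_add p q r, form_smul p q r⟩ _
  refine convexHull_min ?_ hconv hx
  obtain ⟨h1, h2, h3, h4, h5⟩ := h
  have h1' : ((2 * p + 2 * q + 2 * r : ℤ) : ℝ) ≤ c := by exact_mod_cast h1
  have h2' : ((2 * p - q - r : ℤ) : ℝ) ≤ c := by exact_mod_cast h2
  have h3' : ((-p + 2 * q - r : ℤ) : ℝ) ≤ c := by exact_mod_cast h3
  have h4' : ((-p - q + 2 * r : ℤ) : ℝ) ≤ c := by exact_mod_cast h4
  have h5' : ((-2 * p - 2 * q - 2 * r : ℤ) : ℝ) ≤ c := by exact_mod_cast h5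
  push_cast at h1' h2' h3' h4' h5'
  rintro y (rfl | rfl | rfl | rfl | rfl) <;>
    simp [form, po, pp, pq, pr, ps] <;> linarith

/-- A nonzero functional bounded by `c` on a set is strictly below `c` on its interior. -/
lemma form_lt_of_mem_interior {p q r : ℤ} (h0 : (p, q, r) ≠ (0, 0, 0)) {c : ℝ} {S : Set V3}
    (hS : ∀ y ∈ S, form p q r y ≤ c) {x : V3} (hx : x ∈ interior S) : form p q r x < c := by
  set u : V3 := ![p, q, r]
  have hpos : 0 < form p q r u := by
    have : 0 < p * p + q * q + r * r := by
      by_contra! hle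
      exact h0 (by
        simp only [Prod.mk.injEq]
        refine ⟨?_, ?_, ?_⟩ <;> nlinarith [sq_nonneg p, sq_nonneg q, sq_nonneg r])
    simp only [form, u, Matrix.cons_val]
    exact_mod_cast this
  have hcont : Continuous fun t : ℝ => x + t • u := by fun_prop
  have hev : ∀ᶠ t in nhds (0 : ℝ), x + t • u ∈ interior S :=
    hcont.continuousAt.eventually_mem (by simpa using isOpen_interior.mem_nhds hx)
  obtain ⟨t, ht, ht0⟩ :=
    ((hev.filter_mono nhdsWithin_le_nhds).and (self_mem_nhdsWithin (s := Set.Ioi 0))).exists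
  have hle := hS _ (interior_subset ht)
  rw [form_add, form_smul] at hle
  have := mul_pos (Set.mem_Ioi.1 ht0) hpos
  linarith

lemma form_lt_of_mem_interior_F2 {p q r c : ℤ} (h0 : (p, q, r) ≠ (0, 0, 0))
    (h : DimerBound p q r c) {l x : V3} (hx : x ∈ interior ((· + l) '' F2)) :
    form p q r x < c + form p q r l := by
  refine form_lt_of_mem_interior h0 ?_ hx
  rintro _ ⟨y, hy, rfl⟩
  simpa only [form_add, add_le_add_iff_right] using form_le_of_mem_F2 h hy

lemma neg_triple_ne_zero {p q r : ℤ} (h0 : (p, q, r) ≠ (0, 0, 0)) :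
    (-p, -q, -r) ≠ (0, 0, 0) := by
  simpa using h0

lemma lt_form_of_mem_interior_negF2 {p q r c : ℤ} (h0 : (p, q, r) ≠ (0, 0, 0))
    (h : DimerBound p q r c) {m x : V3} (hx : x ∈ interior ((· + m) '' negF2)) :
    form p q r m < c + form p q r x := by
  have := form_lt_of_mem_interior (c := c - form p q r m) (neg_triple_ne_zero h0) ?_ hx
  · rw [form_neg_coeff] at this
    linarith
  rintro _ ⟨_, ⟨y, hy, rfl⟩, rfl⟩
  have := form_le_of_mem_F2 h hy
  simp only [form_neg_coeff, form_add, form_neg]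
  linarith

/-- `3/320` times this is the value of `form p q r` at `i • a + j • b + k • c`. -/
def latticeForm (p q r i j k : ℤ) : ℤ :=
  p * (290 * i - 34 * j + 94 * k) + q * (107 * i + 277 * j - 83 * k)
    + r * (-7 * i + 135 * j + 247 * k)

lemma form_lattice (p q r i j k : ℤ) :
    form p q r ((i : ℝ) • ((3/320 : ℝ) • ![290, 107, -7])
      + (j : ℝ) • ((3/320 : ℝ) • ![-34, 277, 135])
      + (k : ℝ) • ((3/320 : ℝ) • ![94, -83, 247])) = 3 / 320 * latticeForm p q r i j k := by
  simp [form, latticeForm]; ring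

lemma form_offset (p q r : ℤ) :
    form p q r ((1/320 : ℝ) • ![38, 5, -25]) = 1 / 320 * (38 * p + 5 * q - 25 * r : ℤ) := by
  simp [form]; ring

lemma latticeForm_sub (p q r i j k i' j' k' : ℤ) :
    latticeForm p q r (i - i') (j - j') (k - k')
      = latticeForm p q r i j k - latticeForm p q r i' j' k' := by
  simp only [latticeForm]; ring

/-- A nonzero even lattice vector is outside the interior of the difference body of `F2`. -/
lemma eq_zero_of_even {i j k : ℤ} (hpar : Even (i + j + k))
    (h : ∀ p q r c c' : ℤ, (p, q, r) ≠ (0, 0, 0) → DimerBound p q r c →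
      DimerBound (-p) (-q) (-r) c' → 3 * latticeForm p q r i j k < 320 * (c + c')) :
    i = 0 ∧ j = 0 ∧ k = 0 := by
  have := h 1 (-3) (-1) 6 6 (by decide) (by decide) (by decide)
  have := h (-1) 3 1 6 6 (by decide) (by decide) (by decide)
  have := h 3 1 (-1) 6 6 (by decide) (by decide) (by decide)
  have := h (-3) (-1) 1 6 6 (by decide) (by decide) (by decide)
  have := h 1 (-1) 3 6 6 (by decide) (by decide) (by decide)
  have := h (-1) 1 (-3) 6 6 (by decide) (by decide) (by decide)
  have := h 1 (-2) 1 3 6 (by decide) (by decide) (by decide)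
  have := h (-1) 2 (-1) 6 3 (by decide) (by decide) (by decide)
  have := h 2 (-1) (-1) 6 3 (by decide) (by decide) (by decide)
  have := h (-2) 1 1 3 6 (by decide) (by decide) (by decide)
  have := h 1 1 (-1) 2 4 (by decide) (by decide) (by decide)
  have := h (-1) (-1) 1 4 2 (by decide) (by decide) (by decide)
  have := h 1 (-1) (-3) 6 6 (by decide) (by decide) (by decide)
  have := h (-1) 1 3 6 6 (by decide) (by decide) (by decide)
  have := h 1 3 (-1) 6 6 (by decide) (by decide) (by decide)
  have := h (-1) (-3) 1 6 6 (by decide) (by decide) (by decide)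
  have := h 3 (-1) 1 6 6 (by decide) (by decide) (by decide)
  have := h (-3) 1 (-1) 6 6 (by decide) (by decide) (by decide)
  clear h
  simp only [latticeForm] at *
  have : -3 ≤ i := by linarith
  have : i ≤ 3 := by linarith
  have : -3 ≤ j := by linarith
  have : j ≤ 3 := by linarith
  have : -3 ≤ k := by linarith
  have : k ≤ 3 := by linarith
  rw [Int.even_iff] at hpar
  interval_cases i <;> interval_cases j <;> interval_cases k <;> omega

/-- An odd lattice vector plus the offset is outside the interior of `F2 + F2`. -/
lemma false_of_odd {i j k : ℤ} (hpar : Odd (i + j + k))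
    (h : ∀ p q r c : ℤ, (p, q, r) ≠ (0, 0, 0) → DimerBound p q r c →
      3 * latticeForm p q r i j k + (38 * p + 5 * q - 25 * r) < 320 * (c + c)) : False := by
  have := h 1 1 (-1) 2 (by decide) (by decide)
  have := h 1 (-1) 1 2 (by decide) (by decide)
  have := h (-1) 1 1 2 (by decide) (by decide)
  have := h 1 1 (-5) 6 (by decide) (by decide)
  have := h 1 (-5) 1 6 (by decide) (by decide)
  have := h (-5) 1 1 6 (by decide) (by decide)
  clear h
  simp only [latticeForm] at *
  have : -3 ≤ i := by linarith
  have : i ≤ 3 := by linarith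
  have : -3 ≤ j := by linarith
  have : j ≤ 3 := by linarith
  have : -3 ≤ k := by linarith
  have : k ≤ 3 := by linarith
  rw [Int.odd_iff] at hpar
  interval_cases i <;> interval_cases j <;> interval_cases k <;> omega

/-- The interiors of a positive and a negative dimer of the configuration do not meet. -/
lemma disjoint_pos_neg {i j k i' j' k' : ℤ} (hi : Even (i + j + k)) (hi' : Odd (i' + j' + k'))
    {l m x : V3}
    (hl : l = (i : ℝ) • ((3/320 : ℝ) • ![290, 107, -7])
      + (j : ℝ) • ((3/320 : ℝ) • ![-34, 277, 135])
      + (k : ℝ) • ((3/320 : ℝ) • ![94, -83, 247]))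
    (hm : m = (i' : ℝ) • ((3/320 : ℝ) • ![290, 107, -7])
      + (j' : ℝ) • ((3/320 : ℝ) • ![-34, 277, 135])
      + (k' : ℝ) • ((3/320 : ℝ) • ![94, -83, 247]) + (1/320 : ℝ) • ![38, 5, -25])
    (hx : x ∈ interior ((· + l) '' F2)) (hx' : x ∈ interior ((· + m) '' negF2)) : False := by
  refine false_of_odd (i := i' - i) (j := j' - j) (k := k' - k) ?_ ?_
  · rw [show i' - i + (j' - j) + (k' - k) = (i' + j' + k') - (i + j + k) by ring]
    exact hi'.sub_even hi
  intro p q r c h0 hc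
  have h1 := form_lt_of_mem_interior_F2 h0 hc hx
  have h2 := lt_form_of_mem_interior_negF2 h0 hc hx'
  rw [hl, form_lattice] at h1
  rw [hm, form_add, form_lattice, form_offset] at h2
  rw [latticeForm_sub]
  have : (3 * (latticeForm p q r i' j' k' - latticeForm p q r i j k)
      + (38 * p + 5 * q - 25 * r : ℤ) : ℝ) < 320 * (c + c) := by linarith
  exact_mod_cast this

/-- Two translation vectors with indices of the same parity (up to a common offset `e`) agree if
they satisfy the inequalities forced by overlapping interiors. -/
lemma translation_eq_of_overlap {i j k i' j' k' : ℤ} (hpar : Even ((i + j + k) - (i' + j' + k')))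
    {l l' e : V3}
    (hl : l = (i : ℝ) • ((3/320 : ℝ) • ![290, 107, -7])
      + (j : ℝ) • ((3/320 : ℝ) • ![-34, 277, 135])
      + (k : ℝ) • ((3/320 : ℝ) • ![94, -83, 247]) + e)
    (hl' : l' = (i' : ℝ) • ((3/320 : ℝ) • ![290, 107, -7])
      + (j' : ℝ) • ((3/320 : ℝ) • ![-34, 277, 135])
      + (k' : ℝ) • ((3/320 : ℝ) • ![94, -83, 247]) + e)
    (h : ∀ p q r c c' : ℤ, (p, q, r) ≠ (0, 0, 0) → DimerBound p q r c →
      DimerBound (-p) (-q) (-r) c' → form p q r l - form p q r l' < c + c') :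
    l = l' := by
  obtain ⟨h1, h2, h3⟩ := eq_zero_of_even (i := i - i') (j := j - j') (k := k - k')
    (by rwa [show i - i' + (j - j') + (k - k') = (i + j + k) - (i' + j' + k') by ring]) (by
    intro p q r c c' h0 hc hc'
    have := h p q r c c' h0 hc hc'
    rw [hl, hl', form_add p q r _ e, form_add p q r _ e, form_lattice, form_lattice] at this
    rw [latticeForm_sub]
    have : (3 * (latticeForm p q r i j k - latticeForm p q r i' j' k') : ℝ)
      < 320 * (c + c') := by linarith
    exact_mod_cast this)
  rw [hl, hl', sub_eq_zero.1 h1, sub_eq_zero.1 h2, sub_eq_zero.1 h3]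

/-- the double dimer configuration given by the explicit vectors
a = (3/320)·(290,107,−7), b = (3/320)·(−34,277,135), c = (3/320)·(94,−83,247),
d = (1/320)·(38,5,−25) is a packing. -/
theorem dense_double_dimer_is_packing :
    IsPacking (config
      ((3/320 : ℝ) • ![290, 107, -7])
      ((3/320 : ℝ) • ![-34, 277, 135])
      ((3/320 : ℝ) • ![94, -83, 247])
      ((1/320 : ℝ) • ![38, 5, -25])) := by
  intro S hS T hT hne
  rw [Set.eq_empty_iff_forall_notMem]
  rintro x ⟨hxS, hxT⟩
  rcases hS with ⟨l, ⟨i, j, k, hi, hl⟩, rfl⟩ | ⟨l, ⟨i, j, k, hi, hl⟩, rfl⟩ <;>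
    rcases hT with ⟨l', ⟨i', j', k', hi', hl'⟩, rfl⟩ | ⟨l', ⟨i', j', k', hi', hl'⟩, rfl⟩
  · suffices l = l' from hne (by rw [this])
    refine translation_eq_of_overlap (e := 0) (hi.sub hi') (by rw [hl, add_zero])
      (by rw [hl', add_zero]) ?_
    intro p q r c c' h0 hc hc'
    have h1 := form_lt_of_mem_interior_F2 h0 hc hxT
    have h2 := form_lt_of_mem_interior_F2 (neg_triple_ne_zero h0) hc' hxS
    simp only [form_neg_coeff] at h2
    linarith
  · exact disjoint_pos_neg hi hi' hl hl' hxS hxT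
  · exact disjoint_pos_neg hi' hi hl' hl hxT hxS
  · suffices l = l' from hne (by rw [this])
    refine translation_eq_of_overlap (hi.sub_odd hi') hl hl' ?_
    intro p q r c c' h0 hc hc'
    have h1 := lt_form_of_mem_interior_negF2 h0 hc hxS
    have h2 := lt_form_of_mem_interior_negF2 (neg_triple_ne_zero h0) hc' hxT
    simp only [form_neg_coeff] at h2
    linarith
end
end

section
/- Let a = (3/320)·(290,107,−7), b = (3/320)·(−34,277,135), c = (3/320)·(94,−83,247). Then the Lebesgue volume of the positive dimer F₂ equals 18, the unit-cell volume |det[a+b, b+c, c+a]| equals 42039/1000, and consequently the packing density 2·18 / |det[a+b, b+c, c+a]| of the corresponding double dimer configuration equals 4000/4671. -/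
open Matrix MeasureTheory ENNReal

noncomputable section

/-- The simplex with vertices `0` and `t` times the standard basis vectors. -/
def cornerSimplex (n : ℕ) (t : ℝ) : Set (Fin n → ℝ) := {x | (∀ i, 0 ≤ x i) ∧ ∑ i, x i ≤ t}

theorem isClosed_cornerSimplex (n : ℕ) (t : ℝ) : IsClosed (cornerSimplex n t) := by
  simp only [cornerSimplex, Set.ofPred_and, Set.ofPred_forall]
  refine (isClosed_iInter fun i => isClosed_le ?_ ?_).inter (isClosed_le ?_ ?_) <;> fun_prop

theorem cornerSimplex_eq_empty {n : ℕ} {t : ℝ} (ht : t < 0) : cornerSimplex n t = ∅ := by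
  refine Set.eq_empty_of_forall_notMem fun x hx => ?_
  exact absurd (hx.2.trans_lt ht) (not_lt.2 <| Finset.sum_nonneg fun i _ => hx.1 i)

theorem volume_cornerSimplex (n : ℕ) {t : ℝ} (ht : 0 ≤ t) :
    volume (cornerSimplex n t) = ENNReal.ofReal (t ^ n / n.factorial) := by
  induction n generalizing t with
  | zero =>
    have : cornerSimplex 0 t = Set.univ := by ext x; simp [cornerSimplex, ht]
    simp [this, volume_pi]
  | succ n ih =>
    have hslice (x : ℝ) : volume {y : Fin n → ℝ | Fin.cons x y ∈ cornerSimplex (n + 1) t} =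
        (Set.Icc 0 t).indicator
          (fun x => ENNReal.ofReal ((t - x) ^ n / n.factorial)) x := by
      have h : {y : Fin n → ℝ | (Fin.cons x y : Fin (n + 1) → ℝ) ∈ cornerSimplex (n + 1) t} =
          {y | 0 ≤ x ∧ y ∈ cornerSimplex n (t - x)} := by
        ext y
        simp [cornerSimplex, Fin.forall_fin_succ, Fin.sum_univ_succ, and_assoc,
          le_sub_iff_add_le']
      rw [h]
      by_cases h0 : 0 ≤ x
      · by_cases hx : x ≤ t
        · simp [h0, hx, ih (sub_nonneg.2 hx)]
        · simp [hx, cornerSimplex_eq_empty (n := n) (sub_neg.2 (not_le.1 hx))]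
      · simp [h0]
    have hmp := (volume_preserving_piFinSuccAbove (fun _ : Fin (n + 1) => ℝ) 0).symm
    have hmeas := (isClosed_cornerSimplex (n + 1) t).measurableSet
    rw [← hmp.measure_preimage hmeas.nullMeasurableSet, Measure.volume_eq_prod,
      Measure.prod_apply (hmp.measurable hmeas)]
    calc _ = ∫⁻ x : ℝ, (Set.Icc 0 t).indicator
          (fun x => ENNReal.ofReal ((t - x) ^ n / n.factorial)) x := by
          refine lintegral_congr fun x => ?_
          rw [← hslice]
          congr 1
          ext y
          simp [MeasurableEquiv.piFinSuccAbove, Fin.insertNthEquiv]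
      _ = ∫⁻ x in Set.Icc 0 t, ENNReal.ofReal ((t - x) ^ n / n.factorial) :=
          lintegral_indicator measurableSet_Icc _
      _ = ENNReal.ofReal (∫ x in (0:ℝ)..t, (t - x) ^ n / n.factorial) := by
          rw [intervalIntegral.integral_of_le ht, ← integral_Icc_eq_integral_Ioc,
            ofReal_integral_eq_lintegral_ofReal]
          · exact Continuous.integrableOn_Icc (by fun_prop)
          · filter_upwards [ae_restrict_mem measurableSet_Icc] with x hx
            have := sub_nonneg.2 hx.2
            positivity
      _ = _ := by
          rw [intervalIntegral.integral_div,
            intervalIntegral.integral_comp_sub_left (fun x => x ^ n) t, integral_pow,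
            Nat.factorial_succ]
          congr 1
          push_cast
          field_simp
          simp

theorem volume_image_cornerSimplex {n : ℕ} (x : Fin n → ℝ) (M : Matrix (Fin n) (Fin n) ℝ) :
    volume ((fun t => x + M *ᵥ t) '' cornerSimplex n 1) =
      ENNReal.ofReal (|M.det| / n.factorial) := by
  have : (fun t => x + M *ᵥ t) '' cornerSimplex n 1 =
      (x + ·) '' (Matrix.toLin' M '' cornerSimplex n 1) := by
    rw [Set.image_image]; rfl
  rw [this, Set.image_add_left, measure_preimage_add, Measure.addHaar_image_linearMap,
    LinearMap.det_toLin', volume_cornerSimplex n zero_le_one, ← ENNReal.ofReal_mul (abs_nonneg _)]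
  simp [div_eq_mul_inv]

/-- The upper half of the dimer, with apex `po`. -/
def upperHalf : Set V3 :=
  (fun t => po + !![0, -3, -3; -3, 0, -3; -3, -3, 0] *ᵥ t) '' cornerSimplex 3 1

/-- The lower half of the dimer, with apex `ps`. -/
def lowerHalf : Set V3 :=
  (fun t => ps + !![4, 1, 1; 1, 4, 1; 1, 1, 4] *ᵥ t) '' cornerSimplex 3 1

theorem mem_upperHalf {v : V3} :
    v ∈ upperHalf ↔ 0 ≤ v 0 + v 1 + v 2 ∧
      ∀ i, v 0 + v 1 + v 2 ≤ 2 + 2 * v i := by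
  constructor
  · rintro ⟨t, ⟨ht, hs⟩, rfl⟩
    simp [po, dotProduct, Fin.sum_univ_three, Fin.forall_fin_succ] at *
    refine ⟨?_, ?_, ?_, ?_⟩ <;> linarith
  · rintro ⟨h0, h⟩
    refine ⟨fun i => (2 + 2 * v i - (v 0 + v 1 + v 2)) / 6, ⟨fun i => ?_, ?_⟩, ?_⟩
    · linarith [h i]
    · simp only [Fin.sum_univ_three]
      linarith
    · ext i
      fin_cases i <;> simp [po, dotProduct, Fin.sum_univ_three] <;> ring

theorem mem_lowerHalf {v : V3} :
    v ∈ lowerHalf ↔ v 0 + v 1 + v 2 ≤ 0 ∧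
      ∀ i, v 0 + v 1 + v 2 ≤ 6 * v i + 6 := by
  constructor
  · rintro ⟨t, ⟨ht, hs⟩, rfl⟩
    simp [ps, dotProduct, Fin.sum_univ_three, Fin.forall_fin_succ] at *
    refine ⟨?_, ?_, ?_, ?_⟩ <;> linarith
  · rintro ⟨h0, h⟩
    refine ⟨fun i => (6 * v i + 6 - (v 0 + v 1 + v 2)) / 18, ⟨fun i => ?_, ?_⟩, ?_⟩
    · linarith [h i]
    · simp only [Fin.sum_univ_three]
      linarith
    · ext i
      fin_cases i <;> simp [ps, dotProduct, Fin.sum_univ_three] <;> ring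

theorem combination_mem_F2 {x : V3} (hx : x ∈ F2) {t : Fin 3 → ℝ} (ht : t ∈ cornerSimplex 3 1) :
    (1 - ∑ i, t i) • x + t 0 • pp + t 1 • pq + t 2 • pr ∈ F2 := by
  have hv {y : V3} (hy : y ∈ ({po, pp, pq, pr, ps} : Set V3)) : y ∈ F2 :=
    subset_convexHull ℝ _ hy
  have := (convex_convexHull ℝ {po, pp, pq, pr, ps}).sum_mem (t := Finset.univ)
    (w := ![1 - ∑ i, t i, t 0, t 1, t 2]) (z := ![x, pp, pq, pr])
    (by simpa [Fin.forall_fin_succ] using ⟨ht.2, ht.1 0, ht.1 1, ht.1 2⟩)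
    (by simp [Fin.sum_univ_succ])
    (by simpa [Fin.forall_fin_succ] using ⟨hx, hv (by simp), hv (by simp), hv (by simp)⟩)
  simpa [F2, Fin.sum_univ_four] using this

theorem F2_eq_union : F2 = upperHalf ∪ lowerHalf := by
  have hv {y : V3} (hy : y ∈ ({po, pp, pq, pr, ps} : Set V3)) : y ∈ F2 :=
    subset_convexHull ℝ _ hy
  apply Set.Subset.antisymm
  · have hconv : Convex ℝ {v : V3 | ∀ i, v 0 + v 1 + v 2 ≤ 2 + 2 * v i ∧
        v 0 + v 1 + v 2 ≤ 6 * v i + 6} := by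
      intro x hx y hy a b ha hb hab i
      have h1 := mul_le_mul_of_nonneg_left (hx i).1 ha
      have h2 := mul_le_mul_of_nonneg_left (hx i).2 ha
      have h3 := mul_le_mul_of_nonneg_left (hy i).1 hb
      have h4 := mul_le_mul_of_nonneg_left (hy i).2 hb
      simp only [Pi.add_apply, Pi.smul_apply, smul_eq_mul]
      constructor <;> linarith
    have hsub := convexHull_min (s := {po, pp, pq, pr, ps}) (by
      rintro v (rfl | rfl | rfl | rfl | rfl) i <;> fin_cases i <;>
        simp [po, pp, pq, pr, ps] <;> norm_num) hconv
    intro v hvF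
    have h := hsub hvF
    rcases le_total 0 (v 0 + v 1 + v 2) with h0 | h0
    · exact Or.inl (mem_upperHalf.2 ⟨h0, fun i => (h i).1⟩)
    · exact Or.inr (mem_lowerHalf.2 ⟨h0, fun i => (h i).2⟩)
  · rintro v (⟨t, ht, rfl⟩ | ⟨t, ht, rfl⟩)
    · convert combination_mem_F2 (x := po) (hv (by simp)) ht using 1
      ext i
      fin_cases i <;>
        simp [po, pp, pq, pr, dotProduct, Fin.sum_univ_three] <;> ring
    · convert combination_mem_F2 (x := ps) (hv (by simp)) ht using 1
      ext i
      fin_cases i <;>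
        simp [ps, pp, pq, pr, dotProduct, Fin.sum_univ_three] <;> ring

theorem volume_sum_coords_eq_zero : volume {v : V3 | v 0 + v 1 + v 2 = 0} = 0 := by
  let f : V3 →ₗ[ℝ] ℝ :=
    LinearMap.proj (R := ℝ) (φ := fun _ : Fin 3 => ℝ) 0 + LinearMap.proj 1 + LinearMap.proj 2
  refine Measure.addHaar_submodule volume (LinearMap.ker f) fun h => ?_
  have : po ∈ LinearMap.ker f := h ▸ Submodule.mem_top
  simp [f, po] at this
  norm_num at this

theorem volume_F2 : volume F2 = 18 := by
  have hdisj : AEDisjoint volume upperHalf lowerHalf :=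
    measure_mono_null
      (fun v hv => le_antisymm (mem_lowerHalf.1 hv.2).1 (mem_upperHalf.1 hv.1).1)
      volume_sum_coords_eq_zero
  have hmeas : MeasurableSet lowerHalf := by
    have : lowerHalf = {v : V3 | v 0 + v 1 + v 2 ≤ 0 ∧
      ∀ i, v 0 + v 1 + v 2 ≤ 6 * v i + 6} := Set.ext fun v => mem_lowerHalf
    rw [this]
    measurability
  rw [F2_eq_union, measure_union₀ hmeas.nullMeasurableSet hdisj, upperHalf, lowerHalf,
    volume_image_cornerSimplex, volume_image_cornerSimplex,
    ← ENNReal.ofReal_add (by positivity) (by positivity), ← ENNReal.ofReal_ofNat]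
  congr 1
  simp [Matrix.det_fin_three, Nat.factorial]
  norm_num

/-- volume of F₂ is 18, the unit cell volume is 42039/1000, and the
packing density is 4000/4671. -/
theorem dense_double_dimer_density :
    let a : V3 := (3/320 : ℝ) • ![290, 107, -7]
    let b : V3 := (3/320 : ℝ) • ![-34, 277, 135]
    let c : V3 := (3/320 : ℝ) • ![94, -83, 247]
    volume F2 = (18 : ℝ≥0∞) ∧
    |det3 (a + b) (b + c) (c + a)| = 42039/1000 ∧
    2 * 18 / |det3 (a + b) (b + c) (c + a)| = (4000/4671 : ℝ) := by
  intro a b c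
  have hdet : |det3 (a + b) (b + c) (c + a)| = 42039 / 1000 := by
    simp [a, b, c, det3, Matrix.det_fin_three]
    norm_num
  refine ⟨volume_F2, hdet, ?_⟩
  rw [hdet]
  norm_num
end
end

section
/- For any vectors a,b,c,d ∈ ℝ³, the point inversion ι(x) = d+a−x maps the double dimer configuration determined by (a,b,c,d) onto itself, sending positive dimers to negative dimers and vice versa: for every ℓ ∈ L⁺ one has ι(F₂+ℓ) = (−F₂)+(d+a−ℓ) with d+a−ℓ ∈ L⁻, and for every m ∈ L⁻ one has ι((−F₂)+m) = F₂+(d+a−m) with d+a−m ∈ L⁺. In particular, the symmetry group of any double dimer configuration acts transitively on its dimers. -/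
open Matrix MeasureTheory

noncomputable section

/-- the point inversion ι(x) = d+a−x maps the double dimer configuration
onto itself, exchanging positive and negative dimers. -/
theorem inversion_transitive_on_dimers (a b c d : V3) :
    (∀ l ∈ Lplus a b c,
      (fun x => d + a - x) '' ((· + l) '' F2) = (· + (d + a - l)) '' negF2 ∧
      d + a - l ∈ Lminus a b c d) ∧
    (∀ m ∈ Lminus a b c d,
      (fun x => d + a - x) '' ((· + m) '' negF2) = (· + (d + a - m)) '' F2 ∧
      d + a - m ∈ Lplus a b c) := by
  refine ⟨?_, ?_⟩
  · rintro _ ⟨na, nb, nc, h, rfl⟩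
    refine ⟨?_, 1 - na, -nb, -nc, ?_, ?_⟩
    · simp only [negF2, Set.image_image]
      exact Set.image_congr fun x _ => by abel
    · grind
    · push_cast
      module
  · rintro _ ⟨na, nb, nc, h, rfl⟩
    refine ⟨?_, 1 - na, -nb, -nc, ?_, ?_⟩
    · simp only [negF2, Set.image_image]
      exact Set.image_congr fun x _ => by abel
    · grind
    · push_cast
      module
end
end

section
/- For every (u,v,w) ∈ ℝ³, the vectors a = a(u,v,w), b = b(u,v,w), c = c(u,v,w), d = d(u,v,w) of the three-parameter family satisfy all nine linear incidence conditions: F[o,p,q] ∩ (d−F[o,p,q]+a) ≠ ∅, F[o,q,r] ∩ (d−F[o,q,r]+b) ≠ ∅, F[o,r,p] ∩ (d−F[o,r,p]+c) ≠ ∅, F[o,r,p] ∩ (d−F[o,r,p]+a+b+c) ≠ ∅, F[s,r,q] ∩ (d−F[s,r,q]−a) ≠ ∅, F[s,p,r] ∩ (d−F[s,p,r]−b) ≠ ∅, F[s,q,p] ∩ (d−F[s,q,p]−c) ≠ ∅, F[s,q,p] ∩ (d−F[s,q,p]−a−b−c) ≠ ∅, and E[o,q] ∩ (E[s,r]+a+b)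 ≠ ∅. -/
open Matrix MeasureTheory

noncomputable section

/-- Affine combinations of three points lie in their plane. -/
theorem mem_Fpl (x y z t : V3) (α β : ℝ) (h : t = x + α • (y - x) + β • (z - x)) :
    t ∈ Fpl x y z := by
  have hx : x ∈ affineSpan ℝ {x, y, z} := subset_affineSpan ℝ _ (by simp)
  have hy : y ∈ affineSpan ℝ {x, y, z} := subset_affineSpan ℝ _ (by simp)
  have hz : z ∈ affineSpan ℝ {x, y, z} := subset_affineSpan ℝ _ (by simp)
  have := AffineSubspace.smul_vsub_vadd_mem _ β hz hx
    (AffineSubspace.smul_vsub_vadd_mem _ α hy hx hx)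
  simp only [vsub_eq_sub, vadd_eq_add] at this
  rw [h, add_comm, add_comm x]
  exact this

/-- Affine combinations of two points lie on their line. -/
theorem mem_Eln (x y t : V3) (α : ℝ) (h : t = x + α • (y - x)) : t ∈ Eln x y := by
  have := AffineMap.lineMap_mem_affineSpan_pair α x y
  rwa [AffineMap.lineMap_apply, vsub_eq_sub, vadd_eq_add, add_comm, ← h] at this

/-- A set meets its reflection `d - S + t` as soon as it contains the centre `(d + t) / 2`. -/
theorem inter_reflection_nonempty {S : Set V3} {d t : V3} (h : (1 / 2 : ℝ) • (d + t) ∈ S) :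
    (S ∩ ((fun x => d - x + t) '' S)).Nonempty :=
  ⟨_, h, _, h, by module⟩

theorem mem_Fpl_opq {x : V3} (h : x 0 + x 1 - x 2 = 2) : x ∈ Fpl po pp pq := by
  refine mem_Fpl _ _ _ _ ((2 - x 1) / 3) ((2 - x 0) / 3) ?_
  ext i
  fin_cases i <;> simp [po, pp, pq] <;> linarith

theorem mem_Fpl_oqr {x : V3} (h : -x 0 + x 1 + x 2 = 2) : x ∈ Fpl po pq pr := by
  refine mem_Fpl _ _ _ _ ((2 - x 2) / 3) ((2 - x 1) / 3) ?_
  ext i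
  fin_cases i <;> simp [po, pq, pr] <;> linarith

theorem mem_Fpl_orp {x : V3} (h : x 0 - x 1 + x 2 = 2) : x ∈ Fpl po pr pp := by
  refine mem_Fpl _ _ _ _ ((2 - x 0) / 3) ((2 - x 2) / 3) ?_
  ext i
  fin_cases i <;> simp [po, pr, pp] <;> linarith

theorem mem_Fpl_srq {x : V3} (h : 5 * x 0 - x 1 - x 2 = -6) : x ∈ Fpl ps pr pq := by
  refine mem_Fpl _ _ _ _ ((4 * x 2 - x 1 + 6) / 15) ((4 * x 1 - x 2 + 6) / 15) ?_
  ext i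
  fin_cases i <;> simp [ps, pr, pq] <;> linarith

theorem mem_Fpl_spr {x : V3} (h : -x 0 + 5 * x 1 - x 2 = -6) : x ∈ Fpl ps pp pr := by
  refine mem_Fpl _ _ _ _ ((4 * x 0 - x 2 + 6) / 15) ((4 * x 2 - x 0 + 6) / 15) ?_
  ext i
  fin_cases i <;> simp [ps, pp, pr] <;> linarith

theorem mem_Fpl_sqp {x : V3} (h : -x 0 - x 1 + 5 * x 2 = -6) : x ∈ Fpl ps pq pp := by
  refine mem_Fpl _ _ _ _ ((4 * x 1 - x 0 + 6) / 15) ((4 * x 0 - x 1 + 6) / 15) ?_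
  ext i
  fin_cases i <;> simp [ps, pq, pp] <;> linarith

/-- every member of the three-parameter family satisfies all nine
linear incidence conditions. -/
theorem three_parameter_family_satisfies_incidences (u v w : ℝ) :
    let a := av u v w; let b := bv u v w; let c := cv u v w; let d := dv u v w
    (Fpl po pp pq ∩ ((fun x => d - x + a) '' Fpl po pp pq)).Nonempty ∧
    (Fpl po pq pr ∩ ((fun x => d - x + b) '' Fpl po pq pr)).Nonempty ∧
    (Fpl po pr pp ∩ ((fun x => d - x + c) '' Fpl po pr pp)).Nonempty ∧
    (Fpl po pr pp ∩ ((fun x => d - x + (a + b + c)) '' Fpl po pr pp)).Nonempty ∧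
    (Fpl ps pr pq ∩ ((fun x => d - x + (-a)) '' Fpl ps pr pq)).Nonempty ∧
    (Fpl ps pp pr ∩ ((fun x => d - x + (-b)) '' Fpl ps pp pr)).Nonempty ∧
    (Fpl ps pq pp ∩ ((fun x => d - x + (-c)) '' Fpl ps pq pp)).Nonempty ∧
    (Fpl ps pq pp ∩ ((fun x => d - x + (-(a + b + c))) '' Fpl ps pq pp)).Nonempty ∧
    (Eln po pq ∩ ((· + (a + b)) '' Eln ps pr)).Nonempty := by
  intro a b c d
  refine ⟨inter_reflection_nonempty (mem_Fpl_opq ?_), inter_reflection_nonempty (mem_Fpl_oqr ?_),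
    inter_reflection_nonempty (mem_Fpl_orp ?_), inter_reflection_nonempty (mem_Fpl_orp ?_),
    inter_reflection_nonempty (mem_Fpl_srq ?_), inter_reflection_nonempty (mem_Fpl_spr ?_),
    inter_reflection_nonempty (mem_Fpl_sqp ?_), inter_reflection_nonempty (mem_Fpl_sqp ?_),
    ![4 / 5, 2, 4 / 5], mem_Eln _ _ _ (2 / 5) ?_,
    ![-8 / 5, -8 / 5, -2 / 5], mem_Eln _ _ _ (2 / 5) ?_, ?_⟩
  case refine_9 | refine_10 | refine_11 =>
    ext i
    fin_cases i <;> simp [a, b, av, bv, po, pq, pr, ps] <;> ring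
  all_goals
    simp [a, b, c, d, av, bv, cv, dv]
    ring
end
end

section
/- The set of quadruples (a,b,c,d) ∈ (ℝ³)⁴ satisfying all nine linear incidence conditions — F[o,p,q] ∩ (d−F[o,p,q]+a) ≠ ∅, F[o,q,r] ∩ (d−F[o,q,r]+b) ≠ ∅, F[o,r,p] ∩ (d−F[o,r,p]+c) ≠ ∅, F[o,r,p] ∩ (d−F[o,r,p]+a+b+c) ≠ ∅, F[s,r,q] ∩ (d−F[s,r,q]−a) ≠ ∅, F[s,p,r] ∩ (d−F[s,p,r]−b) ≠ ∅, F[s,q,p] ∩ (d−F[s,q,p]−c) ≠ ∅, F[s,q,p] ∩ (d−F[s,q,p]−a−b−c) ≠ ∅, E[o,q] ∩ (E[s,r]+a+b) ≠ ∅ — is exactly the image of the map (u,v,w) ↦ (a(u,v,w), b(u,v,w), c(u,v,w), d(u,v,w)) on ℝ³; in particular it is a three-dimensional affine subspace of (ℝ³)⁴. -/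
open Matrix MeasureTheory

noncomputable section

/-- The nine linear incidence conditions on a quadruple (a,b,c,d). -/
def NineIncidences (a b c d : V3) : Prop :=
  (Fpl po pp pq ∩ ((fun x => d - x + a) '' Fpl po pp pq)).Nonempty ∧
  (Fpl po pq pr ∩ ((fun x => d - x + b) '' Fpl po pq pr)).Nonempty ∧
  (Fpl po pr pp ∩ ((fun x => d - x + c) '' Fpl po pr pp)).Nonempty ∧
  (Fpl po pr pp ∩ ((fun x => d - x + (a + b + c)) '' Fpl po pr pp)).Nonempty ∧
  (Fpl ps pr pq ∩ ((fun x => d - x + (-a)) '' Fpl ps pr pq)).Nonempty ∧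
  (Fpl ps pp pr ∩ ((fun x => d - x + (-b)) '' Fpl ps pp pr)).Nonempty ∧
  (Fpl ps pq pp ∩ ((fun x => d - x + (-c)) '' Fpl ps pq pp)).Nonempty ∧
  (Fpl ps pq pp ∩ ((fun x => d - x + (-(a + b + c))) '' Fpl ps pq pp)).Nonempty ∧
  (Eln po pq ∩ ((· + (a + b)) '' Eln ps pr)).Nonempty

/-- Two non-parallel vectors span the plane orthogonal to their cross product. -/
theorem exists_eq_smul_add_smul_iff_cross_dotProduct_eq_zero {u v : V3} (h : u ⨯₃ v ≠ 0) (w : V3) :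
    (∃ s t : ℝ, w = s • u + t • v) ↔ (u ⨯₃ v) ⬝ᵥ w = 0 := by
  constructor
  · rintro ⟨s, t, rfl⟩
    simp only [cross_apply, vec3_dotProduct, Pi.add_apply, Pi.smul_apply, smul_eq_mul, cons_val]
    ring
  · intro hw
    have hn : (u ⨯₃ v) ⬝ᵥ (u ⨯₃ v) ≠ 0 := by rwa [Ne, dotProduct_self_eq_zero]
    refine ⟨((w ⨯₃ v) ⬝ᵥ (u ⨯₃ v)) / ((u ⨯₃ v) ⬝ᵥ (u ⨯₃ v)),
      ((u ⨯₃ w) ⬝ᵥ (u ⨯₃ v)) / ((u ⨯₃ v) ⬝ᵥ (u ⨯₃ v)), ?_⟩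
    have key : ((u ⨯₃ v) ⬝ᵥ (u ⨯₃ v)) • w =
        ((w ⨯₃ v) ⬝ᵥ (u ⨯₃ v)) • u + ((u ⨯₃ w) ⬝ᵥ (u ⨯₃ v)) • v
          + ((u ⨯₃ v) ⬝ᵥ w) • (u ⨯₃ v) := by
      ext i
      fin_cases i <;> simp only [cross_apply, vec3_dotProduct, Pi.add_apply, Pi.smul_apply, smul_eq_mul,
        cons_val, Fin.zero_eta, Fin.mk_one, Fin.reduceFinMk] <;> ring
    rw [hw, zero_smul, add_zero] at key
    refine (inv_smul_smul₀ hn w).symm.trans ?_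
    rw [key, smul_add, smul_smul, smul_smul, div_eq_inv_mul, div_eq_inv_mul]

theorem mem_Eln_iff {x y m : V3} : m ∈ Eln x y ↔ ∃ s : ℝ, m = x + s • (y - x) := by
  rw [Eln, SetLike.mem_coe, mem_affineSpan_pair_iff_exists_lineMap_eq]
  simp only [AffineMap.lineMap_apply, vsub_eq_sub, vadd_eq_add, eq_comm (b := m), add_comm x]

theorem mem_Fpl_iff {x y z : V3} (h : (y - x) ⨯₃ (z - x) ≠ 0) {m : V3} :
    m ∈ Fpl x y z ↔ ((y - x) ⨯₃ (z - x)) ⬝ᵥ (m - x) = 0 := by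
  rw [← exists_eq_smul_add_smul_iff_cross_dotProduct_eq_zero h, Fpl, SetLike.mem_coe,
    Set.insert_comm, ← affineSpan_insert_affineSpan,
    AffineSubspace.mem_affineSpan_insert_iff (left_mem_affineSpan_pair ℝ x z)]
  refine exists_congr fun s => ⟨?_, ?_⟩
  · rintro ⟨l, hl, rfl⟩
    obtain ⟨t, rfl⟩ := mem_Eln_iff.1 hl
    exact ⟨t, by simp only [vsub_eq_sub, vadd_eq_add]; abel⟩
  · rintro ⟨t, ht⟩
    refine ⟨x + t • (z - x), mem_Eln_iff.2 ⟨t, rfl⟩, ?_⟩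
    rw [sub_eq_iff_eq_add.1 ht, vsub_eq_sub, vadd_eq_add]
    abel

/-- A plane meets its image under `m ↦ d - m + t` iff it contains the centre `(d + t) / 2`. -/
theorem Fpl_inter_reflection_nonempty_iff {x y z : V3} (h : (y - x) ⨯₃ (z - x) ≠ 0) (d t : V3) :
    (Fpl x y z ∩ ((fun m => d - m + t) '' Fpl x y z)).Nonempty ↔
      ((y - x) ⨯₃ (z - x)) ⬝ᵥ (d + t - (x + x)) = 0 := by
  constructor
  · rintro ⟨_, hm, l, hl, rfl⟩
    rw [mem_Fpl_iff h] at hm hl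
    rw [show d + t - (x + x) = (d - l + t - x) + (l - x) by abel, dotProduct_add, hm, hl, add_zero]
  · intro hd
    have hc : (1 / 2 : ℝ) • (d + t) ∈ Fpl x y z := by
      rw [mem_Fpl_iff h, show (1 / 2 : ℝ) • (d + t) - x = (1 / 2 : ℝ) • (d + t - (x + x)) by module,
        dotProduct_smul, hd, smul_zero]
    exact ⟨_, hc, _, hc, by module⟩

theorem Eln_inter_translate_nonempty_iff {x y x' y' : V3} (h : (y - x) ⨯₃ (y' - x') ≠ 0) (t : V3) :
    (Eln x y ∩ ((· + t) '' Eln x' y')).Nonempty ↔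
      ((y - x) ⨯₃ (y' - x')) ⬝ᵥ (x' + t - x) = 0 := by
  rw [← exists_eq_smul_add_smul_iff_cross_dotProduct_eq_zero h]
  constructor
  · rintro ⟨m, hm, l, hl, hlm⟩
    obtain ⟨α, rfl⟩ := mem_Eln_iff.1 hm
    obtain ⟨β, rfl⟩ := mem_Eln_iff.1 hl
    refine ⟨α, -β, ?_⟩
    rw [← sub_eq_zero] at hlm ⊢
    rw [← hlm]
    module
  · rintro ⟨α, β, hw⟩
    refine ⟨_, mem_Eln_iff.2 ⟨α, rfl⟩, _, mem_Eln_iff.2 ⟨-β, rfl⟩, ?_⟩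
    rw [sub_eq_iff_eq_add] at hw
    simp only []
    rw [add_right_comm, hw]
    module

theorem nineIncidences_iff (a b c d : V3) :
    NineIncidences a b c d ↔
      (d 0 + a 0) + (d 1 + a 1) - (d 2 + a 2) = 4 ∧
      -(d 0 + b 0) + (d 1 + b 1) + (d 2 + b 2) = 4 ∧
      (d 0 + c 0) - (d 1 + c 1) + (d 2 + c 2) = 4 ∧
      (a 0 + b 0) - (a 1 + b 1) + (a 2 + b 2) = 0 ∧
      -5 * (d 0 - a 0) + (d 1 - a 1) + (d 2 - a 2) = 12 ∧
      (d 0 - b 0) - 5 * (d 1 - b 1) + (d 2 - b 2) = 12 ∧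
      (d 0 - c 0) + (d 1 - c 1) - 5 * (d 2 - c 2) = 12 ∧
      (a 0 + b 0) + (a 1 + b 1) - 5 * (a 2 + b 2) = 0 ∧
      (a 0 + b 0) + 3 * (a 1 + b 1) - (a 2 + b 2) = 12 := by
  have ne_zero {n : V3} (h : n 0 ≠ 0) : n ≠ 0 := fun hn => h (congrFun hn 0)
  rw [NineIncidences]
  rw [Fpl_inter_reflection_nonempty_iff (ne_zero ?_),
    Fpl_inter_reflection_nonempty_iff (ne_zero ?_),
    Fpl_inter_reflection_nonempty_iff (ne_zero ?_),
    Fpl_inter_reflection_nonempty_iff (ne_zero ?_),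
    Fpl_inter_reflection_nonempty_iff (ne_zero ?_),
    Fpl_inter_reflection_nonempty_iff (ne_zero ?_),
    Fpl_inter_reflection_nonempty_iff (ne_zero ?_),
    Fpl_inter_reflection_nonempty_iff (ne_zero ?_), Eln_inter_translate_nonempty_iff (ne_zero ?_)]
  all_goals simp only [po, pp, pq, pr, ps, cross_apply, vec3_dotProduct, Pi.add_apply, Pi.sub_apply,
    Pi.neg_apply, cons_val]
  any_goals norm_num
  constructor
  · rintro ⟨h1, h2, h3, h4, h5, h6, h7, h8, h9⟩
    refine ⟨?_, ?_, ?_, ?_, ?_, ?_, ?_, ?_, ?_⟩ <;> linarith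
  · rintro ⟨h1, h2, h3, h4, h5, h6, h7, h8, h9⟩
    refine ⟨?_, ?_, ?_, ?_, ?_, ?_, ?_, ?_, ?_⟩ <;> linarith

/-- the quadruples satisfying the nine linear incidence conditions are
exactly the image of the three-parameter family (u,v,w) ↦ (a,b,c,d)(u,v,w). -/
theorem incidence_solutions_eq_three_parameter_family :
    {x : V3 × V3 × V3 × V3 | NineIncidences x.1 x.2.1 x.2.2.1 x.2.2.2} =
      Set.range (fun uvw : ℝ × ℝ × ℝ =>
        (av uvw.1 uvw.2.1 uvw.2.2, bv uvw.1 uvw.2.1 uvw.2.2,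
         cv uvw.1 uvw.2.1 uvw.2.2, dv uvw.1 uvw.2.1 uvw.2.2)) := by
  ext ⟨a, b, c, d⟩
  simp only [Set.mem_ofPred_eq, Set.mem_range, Prod.exists, Prod.mk.injEq, nineIncidences_iff]
  constructor
  · rintro ⟨h1, h2, h3, h4, h5, h6, h7, h8, h9⟩
    refine ⟨d 0 - 1 / 10, (d 1 - d 2) / 2,
      (c 0 - 129 / 160 + (d 0 - 1 / 10) - (d 1 - d 2)) / 2, ?_, ?_, ?_, ?_⟩ <;>
    · ext i
      fin_cases i <;> simp [av, bv, cv, dv] <;> linarith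
  · rintro ⟨u, v, w, rfl, rfl, rfl, rfl⟩
    simp only [av, bv, cv, dv, cons_val]
    refine ⟨?_, ?_, ?_, ?_, ?_, ?_, ?_, ?_, ?_⟩ <;> ring
end
end

section
/- For every (u,v,w) in the restricted parameter space P'', the unit-cell volume V(u,v,w) = (9/25)·(117+60u²−80uv−80v²) satisfies V(u,v,w) ≥ 42039/1000 (equivalently, the packing density 36/V(u,v,w) is at most 4000/4671), with equality if and only if (u,v,w) = (3/320)·(2,5,0) or (u,v,w) = −(3/320)·(2,5,0). In particular P'' contains exactly two configurations of maximal density 4000/4671. -/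
open Matrix MeasureTheory

noncomputable section

/-- on P'' the unit-cell volume is at least 42039/1000, with equality
exactly at the two optimal points ±(3/320)·(2,5,0). -/
theorem optimal_points_in_restricted_parameter_space (u v w : ℝ)
    (h1 : |u/2 + 2*v| ≤ 33/320 + w) (h2 : |v| ≤ 3/64 - w) :
    42039/1000 ≤ (9/25) * (117 + 60*u^2 - 80*u*v - 80*v^2) ∧
    ((9/25) * (117 + 60*u^2 - 80*u*v - 80*v^2) = 42039/1000 ↔
      (u, v, w) = (3/160, 3/64, 0) ∨ (u, v, w) = (-(3/160), -(3/64), 0)) := by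
  have key : (9/25) * (117 + 60*u^2 - 80*u*v - 80*v^2) - 42039/1000 =
      (18/5) * ((3/20)^2 - (u/2 + 3*v)^2) + (18/5) * (5*u/2 - v)^2 := by ring
  have hsum : |u/2 + 3*v| ≤ 3/20 := by
    have := abs_add_le (u/2 + 2*v) v
    rw [show u/2 + 2*v + v = u/2 + 3*v by ring] at this
    linarith
  have hsq : (u/2 + 3*v)^2 ≤ (3/20)^2 := sq_le_sq' (abs_le.mp hsum).1 (abs_le.mp hsum).2
  have hnonneg : 0 ≤ (5*u/2 - v)^2 := sq_nonneg _
  refine ⟨by linarith, fun h => ?_, ?_⟩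
  · have hline : 5*u/2 - v = 0 := pow_eq_zero_iff two_ne_zero |>.mp (by linarith)
    have hbdry : (u/2 + 3*v)^2 = (3/20)^2 := by linarith
    obtain ⟨h1l, h1r⟩ := abs_le.mp h1
    obtain ⟨h2l, h2r⟩ := abs_le.mp h2
    simp only [Prod.mk.injEq]
    rcases sq_eq_sq_iff_eq_or_eq_neg.mp hbdry with h | h
    · left
      refine ⟨?_, ?_, ?_⟩ <;> linarith
    · right
      refine ⟨?_, ?_, ?_⟩ <;> linarith
  · simp only [Prod.mk.injEq]
    rintro (⟨rfl, rfl, -⟩ | ⟨rfl, rfl, -⟩) <;> norm_num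
end
end

section
/- Let T = (1/3)·[[1,−2,−2],[−2,−2,1],[−2,1,−2]]. Then T·F₂ = F₂, and for every (u,v,w) ∈ ℝ³ the linear map x ↦ T·x maps the double dimer configuration determined by (a(u,v,w), b(u,v,w), c(u,v,w), d(u,v,w)) bijectively onto the double dimer configuration determined by (a(−u,−v,w), b(−u,−v,w), c(−u,−v,w), d(−u,−v,w)): it maps L⁺ built from the first quadruple onto L⁺ built from the second, and likewise for L⁻. In particular, the two maximal-density configurations at parameters ±(3/320)·(2,5,0) are isometric via T. -/
open Matrix MeasureTheory

noncomputable section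

/-- The symmetry matrix T. -/
def Tmat : Matrix (Fin 3) (Fin 3) ℝ := (1/3 : ℝ) • !![1, -2, -2; -2, -2, 1; -2, 1, -2]

lemma Tmat_mulVec (x y z : ℝ) :
    Tmat.mulVec ![x, y, z] =
      ![(x - 2 * y - 2 * z) / 3, (-2 * x - 2 * y + z) / 3, (-2 * x + y - 2 * z) / 3] := by
  ext i
  fin_cases i <;> simp [Tmat, Matrix.mulVec, dotProduct, Fin.sum_univ_three] <;> ring

lemma Tmat_mulVec_av (u v w : ℝ) : Tmat.mulVec (av u v w) = -bv (-u) (-v) w := by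
  rw [av, Tmat_mulVec, bv]
  ext i
  fin_cases i <;> simp <;> ring

lemma Tmat_mulVec_bv (u v w : ℝ) : Tmat.mulVec (bv u v w) = -av (-u) (-v) w := by
  rw [bv, Tmat_mulVec, av]
  ext i
  fin_cases i <;> simp <;> ring

lemma Tmat_mulVec_cv (u v w : ℝ) : Tmat.mulVec (cv u v w) = -cv (-u) (-v) w := by
  rw [cv, Tmat_mulVec, cv]
  ext i
  fin_cases i <;> simp <;> ring

lemma Tmat_mulVec_dv (u v w : ℝ) : Tmat.mulVec (dv u v w) = dv (-u) (-v) w := by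
  rw [dv, Tmat_mulVec, dv]
  ext i
  fin_cases i <;> simp <;> ring

lemma Tmat_image_F2 : Tmat.mulVec '' F2 = F2 := by
  have ho : Tmat.mulVec po = ps := by
    rw [po, Tmat_mulVec, ps]; norm_num
  have hp : Tmat.mulVec pp = pp := by
    rw [pp, Tmat_mulVec]; norm_num
  have hq : Tmat.mulVec pq = pr := by
    rw [pq, Tmat_mulVec, pr]; norm_num
  have hr : Tmat.mulVec pr = pq := by
    rw [pr, Tmat_mulVec, pq]; norm_num
  have hs : Tmat.mulVec ps = po := by
    rw [ps, Tmat_mulVec, po]; norm_num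
  have h := Tmat.mulVecLin.image_convexHull {po, pp, pq, pr, ps}
  simp only [Matrix.coe_mulVecLin] at h
  rw [F2, h]
  congr 1
  simp only [Set.image_insert_eq, Set.image_singleton, ho, hp, hq, hr, hs]
  ext x
  simp only [Set.mem_insert_iff, Set.mem_singleton_iff]
  tauto

lemma image_mulVec_image_add (M : Matrix (Fin 3) (Fin 3) ℝ) (S : Set V3) (l : V3) :
    M.mulVec '' ((· + l) '' S) = (· + M.mulVec l) '' (M.mulVec '' S) := by
  simp only [Set.image_image, Matrix.mulVec_add]

lemma image_mulVec_negF2 {M : Matrix (Fin 3) (Fin 3) ℝ} (hM : M.mulVec '' F2 = F2) :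
    M.mulVec '' negF2 = negF2 := by
  conv_rhs => rw [negF2, ← hM]
  simp only [negF2, Set.image_image, Matrix.mulVec_neg]

lemma image_mulVec_Lplus {M : Matrix (Fin 3) (Fin 3) ℝ} {a b c a' b' c' : V3}
    (ha : M.mulVec a = -b') (hb : M.mulVec b = -a') (hc : M.mulVec c = -c') :
    M.mulVec '' Lplus a b c = Lplus a' b' c' := by
  ext x
  constructor
  · rintro ⟨_, ⟨na, nb, nc, hn, rfl⟩, rfl⟩
    refine ⟨-nb, -na, -nc, by grind, ?_⟩
    simp only [Matrix.mulVec_add, Matrix.mulVec_smul, ha, hb, hc]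
    push_cast
    module
  · rintro ⟨na, nb, nc, hn, rfl⟩
    refine ⟨_, ⟨-nb, -na, -nc, by grind, rfl⟩, ?_⟩
    simp only [Matrix.mulVec_add, Matrix.mulVec_smul, ha, hb, hc]
    push_cast
    module

lemma image_mulVec_Lminus {M : Matrix (Fin 3) (Fin 3) ℝ} {a b c d a' b' c' d' : V3}
    (ha : M.mulVec a = -b') (hb : M.mulVec b = -a') (hc : M.mulVec c = -c')
    (hd : M.mulVec d = d') :
    M.mulVec '' Lminus a b c d = Lminus a' b' c' d' := by
  ext x
  constructor
  · rintro ⟨_, ⟨na, nb, nc, hn, rfl⟩, rfl⟩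
    refine ⟨-nb, -na, -nc, by grind, ?_⟩
    simp only [Matrix.mulVec_add, Matrix.mulVec_smul, ha, hb, hc, hd]
    push_cast
    module
  · rintro ⟨na, nb, nc, hn, rfl⟩
    refine ⟨_, ⟨-nb, -na, -nc, by grind, rfl⟩, ?_⟩
    simp only [Matrix.mulVec_add, Matrix.mulVec_smul, ha, hb, hc, hd]
    push_cast
    module

lemma config_eq_image_union_image (a b c d : V3) :
    config a b c d =
      (fun l => (· + l) '' F2) '' Lplus a b c ∪ (fun m => (· + m) '' negF2) '' Lminus a b c d := by
  ext S
  simp only [config, Set.mem_union, Set.mem_ofPred_eq, Set.mem_image, eq_comm]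

lemma image_mulVec_config {M : Matrix (Fin 3) (Fin 3) ℝ} {a b c d a' b' c' d' : V3}
    (hM : M.mulVec '' F2 = F2) (hplus : M.mulVec '' Lplus a b c = Lplus a' b' c')
    (hminus : M.mulVec '' Lminus a b c d = Lminus a' b' c' d') :
    (fun S => M.mulVec '' S) '' config a b c d = config a' b' c' d' := by
  rw [config_eq_image_union_image, config_eq_image_union_image, ← hplus, ← hminus,
    Set.image_union, Set.image_image, Set.image_image, Set.image_image, Set.image_image]
  simp only [image_mulVec_image_add, hM, image_mulVec_negF2 hM]

/-- T fixes the positive dimer and maps the double dimer configuration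
with parameters (u,v,w) bijectively onto the one with parameters (−u,−v,w). -/
theorem symmetry_maps_configurations :
    Tmat.mulVec '' F2 = F2 ∧
    ∀ u v w : ℝ,
      Tmat.mulVec '' Lplus (av u v w) (bv u v w) (cv u v w) =
        Lplus (av (-u) (-v) w) (bv (-u) (-v) w) (cv (-u) (-v) w) ∧
      Tmat.mulVec '' Lminus (av u v w) (bv u v w) (cv u v w) (dv u v w) =
        Lminus (av (-u) (-v) w) (bv (-u) (-v) w) (cv (-u) (-v) w) (dv (-u) (-v) w) ∧
      (fun S => Tmat.mulVec '' S) '' config (av u v w) (bv u v w) (cv u v w) (dv u v w) =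
        config (av (-u) (-v) w) (bv (-u) (-v) w) (cv (-u) (-v) w) (dv (-u) (-v) w) := by
  refine ⟨Tmat_image_F2, fun u v w => ?_⟩
  have hplus := image_mulVec_Lplus (Tmat_mulVec_av u v w) (Tmat_mulVec_bv u v w)
    (Tmat_mulVec_cv u v w)
  have hminus := image_mulVec_Lminus (Tmat_mulVec_av u v w) (Tmat_mulVec_bv u v w)
    (Tmat_mulVec_cv u v w) (Tmat_mulVec_dv u v w)
  exact ⟨hplus, hminus, image_mulVec_config Tmat_image_F2 hplus hminus⟩
end
end

section
/- For every (u,v,w) in the restricted parameter space P'' satisfying 5u+2v = 0 (the Torquato–Jiao two-parameter family), the unit-cell volume V(u,v,w) = (9/25)·(117+60u²−80uv−80v²) satisfies 36/V(u,v,w) ≤ 12250/14319, with equality if and only if (u,v,w) = (3/2240)·(16,−40,−5) or (u,v,w) = (3/2240)·(−16,40,−5). -/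
open Matrix MeasureTheory

noncomputable section

/-- on the Torquato–Jiao plane 5u+2v=0 inside P'', the density is at most
12250/14319, with equality exactly at (3/2240)·(±16,∓40,−5). -/
theorem torquato_jiao_family (u v w : ℝ)
    (h1 : |u/2 + 2*v| ≤ 33/320 + w) (h2 : |v| ≤ 3/64 - w) (h3 : 5*u + 2*v = 0) :
    36 / ((9/25) * (117 + 60*u^2 - 80*u*v - 80*v^2)) ≤ 12250/14319 ∧
    (36 / ((9/25) * (117 + 60*u^2 - 80*u*v - 80*v^2)) = 12250/14319 ↔
      (u, v, w) = (3/140, -(3/56), -(3/448)) ∨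
      (u, v, w) = (-(3/140), 3/56, -(3/448))) := by
  obtain rfl : v = -(5/2) * u := by linarith
  rw [abs_le] at h1 h2
  have hu : u^2 ≤ (3/140)^2 := sq_le_sq' (by linarith) (by linarith)
  have hV : (9/25) * (117 + 60*u^2 - 80*u*(-(5/2) * u) - 80*(-(5/2) * u)^2)
      = (9/25) * (117 - 240*u^2) := by ring
  have hpos : 0 < (9/25) * (117 - 240*u^2) := by linarith
  rw [hV, div_le_iff₀ hpos, div_eq_iff hpos.ne']
  refine ⟨by linarith, fun h => ?_, ?_⟩
  · have hsq : u^2 = (3/140)^2 := by linarith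
    rcases sq_eq_sq_iff_eq_or_eq_neg.mp hsq with rfl | rfl
    · left
      simp only [Prod.mk.injEq]
      exact ⟨trivial, by norm_num, by linarith⟩
    · right
      simp only [Prod.mk.injEq]
      exact ⟨trivial, by norm_num, by linarith⟩
  · rintro (h | h) <;> obtain ⟨rfl, -⟩ := Prod.mk.inj h <;> norm_num
end
end

section
/- The restricted parameter space P'' equals the convex hull of the four points e₁ = (3/10, 0, 3/64), e₂ = (−3/10, 0, 3/64), e₃ = (−3/5, 3/20, −33/320), e₄ = (3/5, −3/20, −33/320); in particular P'' is a (sheared) tetrahedron with these vertices. -/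
open Matrix MeasureTheory

noncomputable section

/-- A convex combination of four points lies in their convex hull. -/
theorem mem_convexHull_of_weights_four {E : Type*} [AddCommGroup E] [Module ℝ E]
    {p₁ p₂ p₃ p₄ : E} {a b c d : ℝ} (ha : 0 ≤ a) (hb : 0 ≤ b) (hc : 0 ≤ c) (hd : 0 ≤ d)
    (h : a + b + c + d = 1) :
    a • p₁ + b • p₂ + c • p₃ + d • p₄ ∈ convexHull ℝ {p₁, p₂, p₃, p₄} := by
  have key := (convex_convexHull ℝ {p₁, p₂, p₃, p₄}).sum_mem (t := Finset.univ)
    (w := ![a, b, c, d]) (z := ![p₁, p₂, p₃, p₄])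
    (by intro i _; fin_cases i <;> simpa)
    (by simpa [Fin.sum_univ_four] using h)
    (by intro i _; apply subset_convexHull; fin_cases i <;> simp)
  simpa [Fin.sum_univ_four] using key

/-- the restricted parameter space P'' is the tetrahedron with vertices
e₁ = (3/10,0,3/64), e₂ = (−3/10,0,3/64), e₃ = (−3/5,3/20,−33/320), e₄ = (3/5,−3/20,−33/320). -/
theorem restricted_parameter_space_is_tetrahedron :
    {x : V3 | |x 0 / 2 + 2 * x 1| ≤ 33/320 + x 2 ∧ |x 1| ≤ 3/64 - x 2} =
      convexHull ℝ {![3/10, 0, 3/64], ![-3/10, 0, 3/64],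
        ![-3/5, 3/20, -33/320], ![3/5, -3/20, -33/320]} := by
  apply Set.Subset.antisymm
  · rintro x ⟨hs, hv⟩
    rw [abs_le] at hs hv
    have hx : x = ((33/320 + x 2 + (x 0 / 2 + 2 * x 1)) * (10/3)) • ![3/10, 0, 3/64]
        + ((33/320 + x 2 - (x 0 / 2 + 2 * x 1)) * (10/3)) • ![-3/10, 0, 3/64]
        + ((3/64 - x 2 + x 1) * (10/3)) • ![-3/5, 3/20, -33/320]
        + ((3/64 - x 2 - x 1) * (10/3)) • ![3/5, -3/20, -33/320] := by
      ext i
      fin_cases i <;> simp <;> ring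
    rw [hx]
    refine mem_convexHull_of_weights_four (by linarith) (by linarith) (by linarith)
      (by linarith) (by ring)
  · refine convexHull_min ?_ ?_
    · rintro x (rfl | rfl | rfl | rfl) <;> norm_num [abs_le, Matrix.cons_val_two]
    · rintro x ⟨hx, hx'⟩ y ⟨hy, hy'⟩ a b ha hb hab
      rw [abs_le] at hx hx' hy hy'
      simp only [Set.mem_ofPred_eq, Pi.add_apply, Pi.smul_apply, smul_eq_mul, abs_le]
      obtain rfl : b = 1 - a := by linarith
      refine ⟨⟨?_, ?_⟩, ?_, ?_⟩ <;> nlinarith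
end
end

section
/- For every (u,v,w) in the restricted parameter space P'', writing a = a(u,v,w), b = b(u,v,w), c = c(u,v,w), d = d(u,v,w): the affine plane a + span{b,c} separates F₂ from F₂+2a (F₂ lies in one closed half-space bounded by the plane and F₂+2a in the other), and the affine plane d/2 + a + span{b,c} separates F₂ from (d−F₂)+2a, where d−F₂ = {d−x : x ∈ F₂}. -/
open Matrix MeasureTheory

noncomputable section

/-- The plane H separates X and Y: H is a genuine plane {x | n⬝x = t} and X lies in
the closed half-space {n⬝x ≤ t} while Y lies in the other closed half-space. -/
def SeparatesPlane (H X Y : Set V3) : Prop :=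
  ∃ (n : V3) (t : ℝ), n ≠ 0 ∧ H = {x | n ⬝ᵥ x = t} ∧
    (∀ x ∈ X, n ⬝ᵥ x ≤ t) ∧ (∀ y ∈ Y, t ≤ n ⬝ᵥ y)

/-- The affine plane through a point spanned by two directions. -/
def planeThrough (x e1 e2 : V3) : Set V3 := {y | ∃ s t : ℝ, y = x + s • e1 + t • e2}

/-- A plane through `x` in directions `e1`, `e2` is the level set of `e1 ⨯₃ e2`, as soon as the first
coordinate of this cross product is nonzero. -/
theorem planeThrough_eq_crossProduct (x e1 e2 : V3)
    (h : e1 1 * e2 2 - e1 2 * e2 1 ≠ 0) :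
    planeThrough x e1 e2 = {y | (e1 ⨯₃ e2) ⬝ᵥ y = (e1 ⨯₃ e2) ⬝ᵥ x} := by
  ext y
  simp only [planeThrough, Set.mem_ofPred_eq, cross_apply, dotProduct, Fin.sum_univ_three,
    cons_val_zero, cons_val_one, cons_val]
  constructor
  · rintro ⟨s, t, rfl⟩
    simp only [Pi.add_apply, Pi.smul_apply, smul_eq_mul]
    ring
  · intro hy
    refine ⟨((y 1 - x 1) * e2 2 - (y 2 - x 2) * e2 1) / (e1 1 * e2 2 - e1 2 * e2 1),
      (e1 1 * (y 2 - x 2) - e1 2 * (y 1 - x 1)) / (e1 1 * e2 2 - e1 2 * e2 1), ?_⟩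
    have h' : e2 2 * e1 1 - e2 1 * e1 2 ≠ 0 := by convert h using 1; ring
    ext i
    fin_cases i <;> simp <;> field_simp <;> linarith

/-- A linear functional bounded on the vertices of the dimer is bounded on the dimer. -/
theorem dotProduct_le_of_mem_F2 {n : V3} {t : ℝ}
    (h : ∀ x ∈ ({po, pp, pq, pr, ps} : Set V3), n ⬝ᵥ x ≤ t) {x : V3} (hx : x ∈ F2) :
    n ⬝ᵥ x ≤ t := by
  have hconv : Convex ℝ {x : V3 | n ⬝ᵥ x ≤ t} :=
    convex_halfSpace_le ⟨dotProduct_add n, fun c x => dotProduct_smul c n x⟩ t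
  exact convexHull_min h hconv hx

section Estimates

variable {u v w : ℝ}

theorem cross_first_coordinate_pos (h1 : |u/2 + 2*v| ≤ 33/320 + w) (h2 : |v| ≤ 3/64 - w) :
    0 < bv u v w 1 * cv u v w 2 - bv u v w 2 * cv u v w 1 := by
  rw [abs_le] at h1 h2
  obtain ⟨h1, h1'⟩ := h1
  obtain ⟨h2, h2'⟩ := h2
  simp [bv, cv]
  nlinarith [mul_nonneg (sub_nonneg.2 h1) (sub_nonneg.2 h1'), mul_nonneg (sub_nonneg.2 h2) (sub_nonneg.2 h2'),
    mul_nonneg (sub_nonneg.2 h1) (sub_nonneg.2 h2), mul_nonneg (sub_nonneg.2 h1) (sub_nonneg.2 h2'),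
    mul_nonneg (sub_nonneg.2 h1') (sub_nonneg.2 h2), mul_nonneg (sub_nonneg.2 h1') (sub_nonneg.2 h2'),
    sq_nonneg (u / 2 + 2 * v), sq_nonneg v]

/-- The width of the dimer in direction `b ⨯₃ c`, with room to spare. -/
theorem abs_dotProduct_add_three_le (h1 : |u/2 + 2*v| ≤ 33/320 + w) (h2 : |v| ≤ 3/64 - w)
    {x : V3} (hx : x ∈ ({po, pp, pq, pr, ps} : Set V3)) :
    |(bv u v w ⨯₃ cv u v w) ⬝ᵥ x| + 3 ≤ (bv u v w ⨯₃ cv u v w) ⬝ᵥ av u v w := by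
  rw [← le_sub_iff_add_le, abs_le]
  rw [abs_le] at h1 h2
  obtain ⟨h1, h1'⟩ := h1
  obtain ⟨h2, h2'⟩ := h2
  simp only [Set.mem_insert_iff, Set.mem_singleton_iff] at hx
  rcases hx with rfl | rfl | rfl | rfl | rfl <;>
  simp [av, bv, cv, po, pp, pq, pr, ps, cross_apply, dotProduct, Fin.sum_univ_three] <;>
  constructor <;>
  nlinarith [mul_nonneg (sub_nonneg.2 h1) (sub_nonneg.2 h1'), mul_nonneg (sub_nonneg.2 h2) (sub_nonneg.2 h2'),
    mul_nonneg (sub_nonneg.2 h1) (sub_nonneg.2 h2), mul_nonneg (sub_nonneg.2 h1) (sub_nonneg.2 h2'),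
    mul_nonneg (sub_nonneg.2 h1') (sub_nonneg.2 h2), mul_nonneg (sub_nonneg.2 h1') (sub_nonneg.2 h2'),
    sq_nonneg (u / 2 + 2 * v), sq_nonneg v]

theorem neg_six_le_dotProduct_dv (h1 : |u/2 + 2*v| ≤ 33/320 + w) (h2 : |v| ≤ 3/64 - w) :
    -6 ≤ (bv u v w ⨯₃ cv u v w) ⬝ᵥ dv u v w := by
  rw [abs_le] at h1 h2
  obtain ⟨h1, h1'⟩ := h1
  obtain ⟨h2, h2'⟩ := h2
  have hu : |u| ≤ 3/5 := abs_le.2 ⟨by linarith, by linarith⟩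
  have hv : |v| ≤ 3/20 := abs_le.2 ⟨by linarith, by linarith⟩
  have hw : |w| ≤ 33/320 := abs_le.2 ⟨by linarith, by linarith⟩
  have mul_bound : ∀ {x y r s : ℝ}, |x| ≤ r → |y| ≤ s → |x * y| ≤ r * s := fun hx hy => by
    rw [abs_mul]
    exact mul_le_mul hx hy (abs_nonneg _) ((abs_nonneg _).trans hx)
  have huu := abs_le.1 (mul_bound hu hu)
  have hvv := abs_le.1 (mul_bound hv hv)
  have hq : |u * u - 4 * (v * v)| ≤ 9/25 :=
    abs_le.2 ⟨by nlinarith [mul_self_nonneg u], by nlinarith [mul_self_nonneg v]⟩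
  have huv := abs_le.1 (mul_bound hu hv)
  have huw := abs_le.1 (mul_bound hu hw)
  have hvw := abs_le.1 (mul_bound hv hw)
  have huq := abs_le.1 (mul_bound hu hq)
  have expand : (bv u v w ⨯₃ cv u v w) ⬝ᵥ dv u v w =
      351/500 + 387/100 * v + 5391/800 * u - 36/5 * (u * v) + 36/5 * (v * v) + 48/5 * (v * w)
        + 9/5 * (u * u) - 18/5 * (u * w) + 3 * (u * (u * u - 4 * (v * v))) := by
    simp [dv, bv, cv, cross_apply, dotProduct, Fin.sum_univ_three]
    ring
  rw [expand]
  linarith [(abs_le.1 hu).1, (abs_le.1 hv).1, mul_self_nonneg u, mul_self_nonneg v]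

end Estimates

/-- for parameters in P'', the plane a + span{b,c} separates F₂ from F₂+2a,
and the plane d/2 + a + span{b,c} separates F₂ from (d−F₂)+2a. -/
theorem separating_planes_for_far_neighbors (u v w : ℝ)
    (h1 : |u/2 + 2*v| ≤ 33/320 + w) (h2 : |v| ≤ 3/64 - w) :
    let a := av u v w; let b := bv u v w; let c := cv u v w; let d := dv u v w
    SeparatesPlane (planeThrough a b c) F2 ((· + (2 : ℝ) • a) '' F2) ∧
    SeparatesPlane (planeThrough ((1/2 : ℝ) • d + a) b c) F2
      ((fun x => d - x + (2 : ℝ) • a) '' F2) := by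
  intro a b c d
  have hpos := cross_first_coordinate_pos h1 h2
  have hne : b ⨯₃ c ≠ 0 := fun h => hpos.ne' (by
    have := congrFun h 0
    simpa [cross_apply] using this)
  have hvert : ∀ x ∈ ({po, pp, pq, pr, ps} : Set V3), |(b ⨯₃ c) ⬝ᵥ x| + 3 ≤ (b ⨯₃ c) ⬝ᵥ a :=
    fun x hx => abs_dotProduct_add_three_le h1 h2 hx
  have hd : -6 ≤ (b ⨯₃ c) ⬝ᵥ d := neg_six_le_dotProduct_dv h1 h2
  have hupper : ∀ x ∈ F2, (b ⨯₃ c) ⬝ᵥ x ≤ (b ⨯₃ c) ⬝ᵥ a - 3 := fun x hx =>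
    dotProduct_le_of_mem_F2 (fun y hy => by linarith [le_abs_self ((b ⨯₃ c) ⬝ᵥ y), hvert y hy]) hx
  have hlower : ∀ x ∈ F2, -((b ⨯₃ c) ⬝ᵥ x) ≤ (b ⨯₃ c) ⬝ᵥ a - 3 := fun x hx => by
    rw [← neg_dotProduct]
    refine dotProduct_le_of_mem_F2 (fun y hy => ?_) hx
    rw [neg_dotProduct]
    linarith [neg_le_abs ((b ⨯₃ c) ⬝ᵥ y), hvert y hy]
  refine ⟨⟨_, _, hne, planeThrough_eq_crossProduct _ _ _ hpos.ne', ?_, ?_⟩,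
    ⟨_, _, hne, planeThrough_eq_crossProduct _ _ _ hpos.ne', ?_, ?_⟩⟩
  · intro x hx
    linarith [hupper x hx]
  · rintro _ ⟨x, hx, rfl⟩
    simp only [dotProduct_add, dotProduct_smul, smul_eq_mul]
    linarith [hlower x hx]
  · intro x hx
    simp only [dotProduct_add, dotProduct_smul, smul_eq_mul]
    linarith [hupper x hx]
  · rintro _ ⟨x, hx, rfl⟩
    simp only [dotProduct_add, dotProduct_sub, dotProduct_smul, smul_eq_mul]
    linarith [hupper x hx]
end
end

section
/- For every (u,v,w) in the restricted parameter space P'', writing a = a(u,v,w), b = b(u,v,w), c = c(u,v,w), d = d(u,v,w): the affine plane F[o,p,q] through o, p, q separates the positive dimer F₂ from the translated negative dimer (d−F₂)+a+b−c, where d−F₂ = {d−x : x ∈ F₂}; in particular these two dimers have disjoint interiors. -/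
open Matrix MeasureTheory

noncomputable section

/-- An affine hyperplane `{x | n ⬝ᵥ x = t}` as an affine subspace. -/
def dotHyperplane (n : V3) (t : ℝ) : AffineSubspace ℝ V3 where
  carrier := {x | n ⬝ᵥ x = t}
  smul_vsub_vadd_mem' k x y z hx hy hz := by
    simp only [Set.mem_ofPred_eq] at hx hy hz ⊢
    simp [dotProduct_add, dotProduct_smul, dotProduct_sub, hx, hy, hz]

theorem dotProduct_opq_normal (x : V3) : ![1, 1, -1] ⬝ᵥ x = x 0 + x 1 - x 2 := by
  simp [dotProduct, Fin.sum_univ_three]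
  ring

theorem Fpl_opq_eq : Fpl po pp pq = {x | ![1, 1, -1] ⬝ᵥ x = 2} := by
  apply Set.Subset.antisymm
  · have h : affineSpan ℝ {po, pp, pq} ≤ dotHyperplane ![1, 1, -1] 2 := by
      rw [affineSpan_le]
      rintro x (rfl | rfl | rfl) <;>
        change ![1, 1, -1] ⬝ᵥ _ = (2 : ℝ) <;>
        rw [dotProduct_opq_normal] <;> simp only [po, pp, pq, cons_val] <;> norm_num
    exact h
  · intro x hx
    rw [Set.mem_ofPred_eq, dotProduct_opq_normal] at hx
    have ho : po ∈ affineSpan ℝ {po, pp, pq} := mem_affineSpan ℝ (by simp)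
    have hp : pp ∈ affineSpan ℝ {po, pp, pq} := mem_affineSpan ℝ (by simp)
    have hq : pq ∈ affineSpan ℝ {po, pp, pq} := mem_affineSpan ℝ (by simp)
    have h := AffineSubspace.smul_vsub_vadd_mem _ ((2 - x 0) / 3) hq ho
      (AffineSubspace.smul_vsub_vadd_mem _ ((2 - x 1) / 3) hp ho ho)
    have hx' : x = ((2 - x 0) / 3) • (pq -ᵥ po) +ᵥ (((2 - x 1) / 3) • (pp -ᵥ po) +ᵥ po) := by
      ext i
      fin_cases i <;> simp [po, pp, pq] <;> linarith
    rw [hx']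
    exact h

theorem dotProduct_opq_normal_le_of_mem_F2 {x : V3} (hx : x ∈ F2) :
    ![1, 1, -1] ⬝ᵥ x ≤ 2 := by
  have hconv : Convex ℝ {x : V3 | ![1, 1, -1] ⬝ᵥ x ≤ 2} :=
    convex_halfSpace_le ⟨dotProduct_add _, fun k y => dotProduct_smul k _ y⟩ 2
  refine convexHull_min ?_ hconv hx
  rintro y (rfl | rfl | rfl | rfl | rfl) <;>
    rw [Set.mem_ofPred_eq, dotProduct_opq_normal] <;>
    simp only [po, pp, pq, pr, ps, cons_val] <;> norm_num

/-- for parameters in P'', the plane F[o,p,q] separates F₂ from the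
translated negative dimer (d−F₂)+a+b−c; in particular their interiors are disjoint. -/
theorem face_plane_separates_neighbor (u v w : ℝ)
    (h1 : |u/2 + 2*v| ≤ 33/320 + w) (h2 : |v| ≤ 3/64 - w) :
    let a := av u v w; let b := bv u v w; let c := cv u v w; let d := dv u v w
    SeparatesPlane (Fpl po pp pq) F2 ((fun x => d - x + (a + b - c)) '' F2) ∧
    interior F2 ∩ interior ((fun x => d - x + (a + b - c)) '' F2) = ∅ := by
  intro a b c d
  have hF : ∀ x ∈ F2, ![1, 1, -1] ⬝ᵥ x ≤ 2 := fun x hx => dotProduct_opq_normal_le_of_mem_F2 hx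
  have hoff : 4 < ![1, 1, -1] ⬝ᵥ (d + (a + b - c)) := by
    rw [dotProduct_opq_normal]
    simp only [a, b, c, d, av, bv, cv, dv, Pi.add_apply, Pi.sub_apply, cons_val]
    linarith [(abs_le.mp h1).1, (abs_le.mp h2).2]
  have hG : ∀ y ∈ (fun x => d - x + (a + b - c)) '' F2, 2 < ![1, 1, -1] ⬝ᵥ y := by
    rintro _ ⟨x, hx, rfl⟩
    have hxle := hF x hx
    simp only [dotProduct_add, dotProduct_sub] at hoff hxle ⊢
    linarith
  refine ⟨⟨![1, 1, -1], 2, fun h => by simpa using congrFun h 0, Fpl_opq_eq, hF,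
    fun y hy => (hG y hy).le⟩, Set.eq_empty_of_forall_notMem ?_⟩
  rintro y ⟨hy, hy'⟩
  exact (hF y (interior_subset hy)).not_gt (hG y (interior_subset hy'))
end
end

section
/- For every (u,v,w) ∈ ℝ³, writing a = a(u,v,w), b = b(u,v,w): the vertex p lies on the translated affine line E[r,q]+a−b (the line through r+a−b and q+a−b) if and only if u = 0. Hence the vertex-to-edge incidence H_{a−b} can occur only on the central plane u = 0 of the three-parameter family. -/
open Matrix MeasureTheory

noncomputable section

/-- the vertex-to-edge incidence H_{a−b} occurs exactly on the central
plane u = 0. -/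
theorem vertex_edge_incidence_iff (u v w : ℝ) :
    pp ∈ (· + (av u v w - bv u v w)) '' Eln pr pq ↔ u = 0 := by
  constructor
  · rintro ⟨x, hx, hp⟩
    obtain ⟨t, rfl⟩ := mem_affineSpan_pair_iff_exists_lineMap_eq.1 hx
    have h := congrFun hp 0
    simp [AffineMap.lineMap_apply, pp, pq, pr, av, bv] at h
    linarith
  · rintro rfl
    refine ⟨AffineMap.lineMap pr pq (1 / 2 + 2 * v / 3 : ℝ),
      AffineMap.lineMap_mem_affineSpan_pair _ _ _, ?_⟩
    ext i
    fin_cases i <;> simp [AffineMap.lineMap_apply, pp, pq, pr, av, bv] <;> ring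
end
end

section
/- For every (u,v,w) ∈ ℝ³, writing a = a(u,v,w), b = b(u,v,w): the positive dimer F₂ and its translate F₂+(a−b) have disjoint interiors; that is, the neighbor at a−b never overlaps the dimer at the origin anywhere in the three-parameter family. -/
open Matrix MeasureTheory

noncomputable section

/-- The functional `x ↦ 2x₀ - x₁ - x₂`, whose width on the dimer is `9`. -/
def separatingFunctional : V3 →ₗ[ℝ] ℝ :=
  (2 : ℝ) • LinearMap.proj 0 - LinearMap.proj 1 - LinearMap.proj 2

lemma separatingFunctional_apply (x : V3) :
    separatingFunctional x = 2 * x 0 - x 1 - x 2 := by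
  simp [separatingFunctional]

lemma separatingFunctional_surjective : Function.Surjective separatingFunctional := fun c =>
  ⟨![c / 2, 0, 0], by simp [separatingFunctional_apply]; ring⟩

lemma separatingFunctional_mem_Icc {x : V3} (hx : x ∈ F2) :
    separatingFunctional x ∈ Set.Icc (-3 : ℝ) 6 := by
  have hsub : F2 ⊆ separatingFunctional ⁻¹' Set.Icc (-3 : ℝ) 6 := by
    refine convexHull_min ?_ ((convex_Icc _ _).linear_preimage _)
    rintro y (rfl | rfl | rfl | rfl | rfl) <;>
      simp only [Set.mem_preimage, Set.mem_Icc, separatingFunctional_apply] <;>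
      simp [po, pp, pq, pr, ps] <;> norm_num
  exact hsub hx

lemma separatingFunctional_lt_of_mem_interior {x : V3} (hx : x ∈ interior F2) :
    separatingFunctional x < 6 := by
  have hopen : IsOpenMap separatingFunctional :=
    separatingFunctional.isOpenMap_of_finiteDimensional separatingFunctional_surjective
  have himage : separatingFunctional '' interior F2 ⊆ Set.Iic 6 := by
    rintro _ ⟨y, hy, rfl⟩
    exact (separatingFunctional_mem_Icc (interior_subset hy)).2
  have hmem := interior_maximal himage (hopen _ isOpen_interior) ⟨x, hx, rfl⟩
  rwa [interior_Iic] at hmem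

lemma separatingFunctional_av_sub_bv (u v w : ℝ) :
    separatingFunctional (av u v w - bv u v w) = 9 := by
  simp [separatingFunctional_apply, av, bv]
  ring

/-- throughout the three-parameter family, the positive dimer F₂ and its
translate F₂+(a−b) have disjoint interiors. -/
theorem neighbor_a_sub_b_never_overlaps (u v w : ℝ) :
    interior F2 ∩ interior ((· + (av u v w - bv u v w)) '' F2) = ∅ := by
  refine Set.eq_empty_of_forall_notMem ?_
  rintro x ⟨hx, hx'⟩
  obtain ⟨y, hy, rfl⟩ := interior_subset hx'
  have hlt := separatingFunctional_lt_of_mem_interior hx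
  have hge := (separatingFunctional_mem_Icc hy).1
  simp only [map_add, separatingFunctional_av_sub_bv] at hlt
  linarith
end
end

section
/- Let B₁ be the regular tetrahedron with vertices (1,1,1), (1,−1,−1), (−1,1,−1), (−1,−1,1), and let Λ be the lattice generated by a = (2,−1/3,−1/3), b = (−1/3,2,−1/3), c = (−1/3,−1/3,2). Then for any two distinct lattice vectors ℓ, ℓ' ∈ Λ the translates B₁+ℓ and B₁+ℓ' have disjoint interiors; moreover the Lebesgue volume of B₁ is 8/3, |det[a,b,c]| = 196/27, and hence the density (8/3)/(196/27) of this lattice packing equals 18/49. -/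
open Matrix MeasureTheory ENNReal

noncomputable section

/-- The regular tetrahedron B₁. -/
def B1 : Set V3 := convexHull ℝ {![1,1,1], ![1,-1,-1], ![-1,1,-1], ![-1,-1,1]}

/-- The lattice generated by a, b, c. -/
def Lat3 (a b c : V3) : Set V3 :=
  {x | ∃ na nb nc : ℤ, x = (na : ℝ) • a + (nb : ℝ) • b + (nc : ℝ) • c}

/-- The facet inequalities of `B1`. -/
theorem mem_B1_iff (x : V3) :
    x ∈ B1 ↔ |x 1 + x 2| ≤ 1 + x 0 ∧ |x 1 - x 2| ≤ 1 - x 0 := by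
  constructor
  · intro hx
    have hconv : Convex ℝ {y : V3 | |y 1 + y 2| ≤ 1 + y 0 ∧ |y 1 - y 2| ≤ 1 - y 0} := by
      intro p hp q hq s t hs ht hst
      simp only [Set.mem_ofPred_eq, abs_le, Pi.add_apply, Pi.smul_apply, smul_eq_mul] at *
      obtain ⟨⟨hp1, hp2⟩, hp3, hp4⟩ := hp
      obtain ⟨⟨hq1, hq2⟩, hq3, hq4⟩ := hq
      refine ⟨⟨?_, ?_⟩, ?_, ?_⟩
      · linear_combination s * hp1 + t * hq1 + hst
      · linear_combination s * hp2 + t * hq2 + hst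
      · linear_combination s * hp3 + t * hq3 + hst
      · linear_combination s * hp4 + t * hq4 + hst
    refine convexHull_min ?_ hconv hx
    rintro y (rfl | rfl | rfl | rfl) <;> simp [abs_le, Matrix.cons_val_two] <;> norm_num
  · rintro ⟨h1, h2⟩
    rw [abs_le] at h1 h2
    let w : Fin 4 → ℝ := ![(1 + x 0 + x 1 + x 2) / 4, (1 + x 0 - x 1 - x 2) / 4,
      (1 - x 0 + x 1 - x 2) / 4, (1 - x 0 - x 1 + x 2) / 4]
    let v : Fin 4 → V3 := ![![1, 1, 1], ![1, -1, -1], ![-1, 1, -1], ![-1, -1, 1]]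
    have hx : x = ∑ i, w i • v i := by
      ext j
      fin_cases j <;> simp [w, v, Fin.sum_univ_four] <;> ring
    rw [hx]
    refine (convex_convexHull ℝ _).sum_mem ?_ ?_ ?_
    · intro i _
      fin_cases i <;> simp [w] <;> linarith
    · simp only [Fin.sum_univ_four, w]
      simp
      ring
    · intro i _
      apply subset_convexHull
      fin_cases i <;> simp [v]

/-- A surjective linear functional that is bounded on a set is strictly bounded on its interior. -/
theorem mem_Ioo_of_mem_interior {E : Type*} [AddCommGroup E] [Module ℝ E] [TopologicalSpace E]
    [IsTopologicalAddGroup E] [ContinuousSMul ℝ E] (f : E →ₗ[ℝ] ℝ) (hf : Function.Surjective f)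
    {S : Set E} {p q : ℝ} (h : ∀ x ∈ S, f x ∈ Set.Icc p q) {x : E} (hx : x ∈ interior S) :
    f x ∈ Set.Ioo p q := by
  rw [← interior_Icc]
  refine interior_maximal ?_ (f.isOpenMap_of_finiteDimensional hf _ isOpen_interior)
    (Set.mem_image_of_mem f hx)
  rintro _ ⟨y, hy, rfl⟩
  exact h y (interior_subset hy)

/-- Differences of interior points of `B1` lie in the open cuboctahedron `B1 - B1`. -/
theorem sub_bounds_of_mem_interior_B1 {x y : V3} (hx : x ∈ interior B1) (hy : y ∈ interior B1) :
    (∀ i, |x i - y i| < 2) ∧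
      ∀ e : Fin 3 → ℝ, (∀ i, e i = 1 ∨ e i = -1) → |∑ i, e i * (x i - y i)| < 4 := by
  constructor
  · intro i
    have key : ∀ z ∈ B1, LinearMap.proj (R := ℝ) (φ := fun _ : Fin 3 => ℝ) i z
        ∈ Set.Icc (-1 : ℝ) 1 := by
      intro z hz
      obtain ⟨h1, h2⟩ := (mem_B1_iff z).1 hz
      rw [abs_le] at h1 h2
      fin_cases i <;> simp <;> constructor <;> linarith
    have hs := LinearMap.proj_surjective (R := ℝ) (φ := fun _ : Fin 3 => ℝ) i
    obtain ⟨h1, h2⟩ := mem_Ioo_of_mem_interior _ hs key hx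
    obtain ⟨h3, h4⟩ := mem_Ioo_of_mem_interior _ hs key hy
    simp only [LinearMap.proj_apply] at h1 h2 h3 h4
    rw [abs_lt]
    constructor <;> linarith
  · intro e he
    let f : V3 →ₗ[ℝ] ℝ := ∑ i, e i • LinearMap.proj i
    have hf : ∀ z, f z = ∑ i, e i * z i := by
      intro z
      simp [f]
    have hs : Function.Surjective f := by
      intro r
      refine ⟨![e 0 * r, 0, 0], ?_⟩
      rw [hf]
      rcases he 0 with h | h <;> simp [Fin.sum_univ_three, h]
    have key : ∃ p : ℝ, ∀ z ∈ B1, f z ∈ Set.Icc p (p + 4) := by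
      refine ⟨if e 0 * e 1 * e 2 = 1 then -1 else -3, ?_⟩
      intro z hz
      obtain ⟨h1, h2⟩ := (mem_B1_iff z).1 hz
      rw [abs_le] at h1 h2
      rw [hf, Fin.sum_univ_three]
      rcases he 0 with h | h <;> rcases he 1 with h' | h' <;> rcases he 2 with h'' | h'' <;>
        norm_num [h, h', h''] <;> constructor <;> linarith
    obtain ⟨p, key⟩ := key
    obtain ⟨h1, h2⟩ := mem_Ioo_of_mem_interior f hs key hx
    obtain ⟨h3, h4⟩ := mem_Ioo_of_mem_interior f hs key hy
    have : ∑ i, e i * (x i - y i) = f x - f y := by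
      simp only [hf, mul_sub, Finset.sum_sub_distrib]
    rw [this, abs_lt]
    constructor <;> linarith

/-- The only vector of the lattice `Lat3 a b c` in the open cuboctahedron `B1 - B1` is zero;
here in integer coordinates, scaled by `3`. -/
theorem eq_zero_of_lattice_bounds {k l m : ℤ}
    (hk : |6 * k - l - m| < 6) (hl : |6 * l - k - m| < 6) (hm : |6 * m - k - l| < 6)
    (h₀ : |4 * k + 4 * l + 4 * m| < 12)
    (h₁ : |(6 * k - l - m) - (6 * l - k - m) - (6 * m - k - l)| < 12)
    (h₂ : |-(6 * k - l - m) + (6 * l - k - m) - (6 * m - k - l)| < 12)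
    (h₃ : |-(6 * k - l - m) - (6 * l - k - m) + (6 * m - k - l)| < 12) :
    k = 0 ∧ l = 0 ∧ m = 0 := by
  rw [abs_lt] at *
  omega

theorem volume_square_slices :
    volume {q : V3 | |q 1| ≤ 1 + q 0 ∧ |q 2| ≤ 1 - q 0} = 16 / 3 := by
  set P := {q : V3 | |q 1| ≤ 1 + q 0 ∧ |q 2| ≤ 1 - q 0}
  have hP : MeasurableSet P := by
    apply IsClosed.measurableSet
    have h₁ : IsClosed {q : V3 | |q 1| ≤ 1 + q 0} := isClosed_le (by fun_prop) (by fun_prop)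
    have h₂ : IsClosed {q : V3 | |q 2| ≤ 1 - q 0} := isClosed_le (by fun_prop) (by fun_prop)
    exact h₁.inter h₂
  have hmp := (volume_preserving_piFinSuccAbove (fun _ : Fin 3 => ℝ) 0).symm
  have hslice (t : ℝ) : volume (Prod.mk t ⁻¹'
      ((MeasurableEquiv.piFinSuccAbove (fun _ : Fin 3 => ℝ) 0).symm ⁻¹' P)) =
      (Set.Icc (-1) 1).indicator (fun t : ℝ => ENNReal.ofReal (4 * (1 - t ^ 2))) t := by
    have h : Prod.mk t ⁻¹' ((MeasurableEquiv.piFinSuccAbove (fun _ : Fin 3 => ℝ) 0).symm ⁻¹' P) =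
        Set.Icc ![-(1 + t), -(1 - t)] ![1 + t, 1 - t] := by
      ext q
      have h2 : (Fin.cons t q : V3) 2 = q 1 := rfl
      simp only [P, Set.mem_preimage, Set.mem_ofPred_eq, Set.mem_Icc, Pi.le_def, Fin.forall_fin_two,
        abs_le]
      simp [MeasurableEquiv.piFinSuccAbove, Fin.insertNthEquiv, h2]
      tauto
    rw [h, Real.volume_Icc_pi, Fin.prod_univ_two]
    by_cases ht : t ∈ Set.Icc (-1 : ℝ) 1
    · rw [Set.indicator_of_mem ht]
      obtain ⟨h1, h2⟩ := ht
      rw [← ENNReal.ofReal_mul (by simp; linarith)]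
      congr 1
      simp
      ring
    · rw [Set.indicator_of_notMem ht]
      rw [Set.mem_Icc, not_and_or, not_le, not_le] at ht
      rcases ht with ht | ht
      · rw [ENNReal.ofReal_of_nonpos (by simp; linarith), zero_mul]
      · rw [mul_comm, ENNReal.ofReal_of_nonpos (by simp; linarith), zero_mul]
  rw [← hmp.measure_preimage hP.nullMeasurableSet, Measure.volume_eq_prod,
    Measure.prod_apply (hP.preimage (MeasurableEquiv.measurable _))]
  simp_rw [hslice]
  rw [lintegral_indicator measurableSet_Icc, ← ofReal_integral_eq_lintegral_ofReal,
    integral_Icc_eq_integral_Ioc, ← intervalIntegral.integral_of_le (by norm_num)]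
  · have : ∫ t in (-1 : ℝ)..1, 4 * (1 - t ^ 2) = 16 / 3 := by
      simp
      norm_num
    rw [this, ENNReal.ofReal_div_of_pos (by norm_num)]
    norm_num
  · exact Continuous.integrableOn_Icc (by fun_prop)
  · filter_upwards [ae_restrict_mem measurableSet_Icc] with t ht
    have := ht.1
    have := ht.2
    simp only [Pi.zero_apply]
    nlinarith

theorem volume_B1 : volume B1 = 8 / 3 := by
  let M : Matrix (Fin 3) (Fin 3) ℝ := !![1, 0, 0; 0, 1, 1; 0, 1, -1]
  have hdet : LinearMap.det (Matrix.toLin' M) = -2 := by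
    simp [M, LinearMap.det_toLin', Matrix.det_fin_three]
    norm_num
  have hB : B1 = Matrix.toLin' M ⁻¹' {q : V3 | |q 1| ≤ 1 + q 0 ∧ |q 2| ≤ 1 - q 0} := by
    ext x
    rw [mem_B1_iff]
    simp [M, Matrix.mulVec, dotProduct, Fin.sum_univ_three, sub_eq_add_neg]
  rw [hB, Measure.addHaar_preimage_linearMap _ (by rw [hdet]; norm_num), hdet,
    volume_square_slices]
  rw [← ENNReal.toReal_eq_toReal_iff' (by finiteness) (by finiteness)]
  norm_num

theorem interior_image_add_right (S : Set V3) (l z : V3) :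
    z ∈ interior ((· + l) '' S) ↔ z - l ∈ interior S := by
  have h := (Homeomorph.addRight l).image_interior S
  simp only [Homeomorph.coe_addRight] at h
  rw [← h, Set.image_add_right, Set.mem_preimage, sub_eq_add_neg]

/-- Hoylman's densest lattice packing of a single tetrahedron, with
density 18/49. -/
theorem densest_lattice_tetrahedron_packing :
    let a : V3 := ![2, -1/3, -1/3]
    let b : V3 := ![-1/3, 2, -1/3]
    let c : V3 := ![-1/3, -1/3, 2]
    (∀ l ∈ Lat3 a b c, ∀ l' ∈ Lat3 a b c, l ≠ l' →
      interior ((· + l) '' B1) ∩ interior ((· + l') '' B1) = ∅) ∧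
    volume B1 = (8/3 : ℝ≥0∞) ∧
    |det3 a b c| = 196/27 ∧
    (8/3 : ℝ) / (196/27) = 18/49 := by
  intro a b c
  refine ⟨?_, volume_B1, ?_, by norm_num⟩
  · rintro l ⟨k₁, k₂, k₃, rfl⟩ l' ⟨m₁, m₂, m₃, rfl⟩ hne
    rw [Set.eq_empty_iff_forall_notMem]
    rintro z ⟨hz, hz'⟩
    rw [interior_image_add_right] at hz hz'
    obtain ⟨hcoord, hsum⟩ := sub_bounds_of_mem_interior_B1 hz' hz
    have h0 := hcoord 0
    have h1 := hcoord 1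
    have h2 := hcoord 2
    have hs0 := hsum ![1, 1, 1] (by simp [Fin.forall_fin_succ])
    have hs1 := hsum ![1, -1, -1] (by simp [Fin.forall_fin_succ])
    have hs2 := hsum ![-1, 1, -1] (by simp [Fin.forall_fin_succ])
    have hs3 := hsum ![-1, -1, 1] (by simp [Fin.forall_fin_succ])
    simp only [Fin.sum_univ_three] at hs0 hs1 hs2 hs3
    simp [a, b, c, abs_lt] at h0 h1 h2 hs0 hs1 hs2 hs3
    have key : k₁ - m₁ = 0 ∧ k₂ - m₂ = 0 ∧ k₃ - m₃ = 0 := by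
      clear hz hz' hcoord hsum hne
      clear_value a b c
      apply eq_zero_of_lattice_bounds <;> rw [abs_lt] <;> rify
      · constructor <;> linarith only [h0.1, h0.2]
      · constructor <;> linarith only [h1.1, h1.2]
      · constructor <;> linarith only [h2.1, h2.2]
      · constructor <;> linarith only [hs0.1, hs0.2]
      · constructor <;> linarith only [hs1.1, hs1.2]
      · constructor <;> linarith only [hs2.1, hs2.2]
      · constructor <;> linarith only [hs3.1, hs3.2]
    obtain ⟨e1, e2, e3⟩ := key
    rw [sub_eq_zero] at e1 e2 e3
    exact hne (by rw [e1, e2, e3])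
  · have h : det3 a b c = 196 / 27 := by
      simp [det3, Matrix.det_fin_three, a, b, c]
      norm_num
    rw [h]
    norm_num
end
end
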